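/- Let G be a group of F-type. If G is not solvable, then G has a subgroup of finite index that admits a surjective homomorphism onto a free group of rank 2. In particular, every group of F-type is either SQ-universal or solvable. -/

import Mathlib

open scoped MatrixGroups

namespace FPaper

/-- A (reduced) word in a free group is *cyclically reduced* if its first letter is not the
formal inverse of its last letter. -/
def CyclicallyReduced {α : Type*} [DecidableEq α] (w : FreeGroup α) : Prop :=
  ∀ x y : α × Bool, w.toWord.head? = some x → w.toWord.getLast? = some y →
    x.1 = y.1 → x.2 = y.2

/-- The combinatorial data of a presentation of F-type:
`⟨a_1, …, a_n ∣ a_1^{e_1} = ⋯ = a_n^{e_n} = U V = 1⟩` with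
`U = U(a_1, …, a_p)` and `V = V(a_{p+1}, …, a_n)`. -/
structure FTypeBase where
  n : ℕ
  e : Fin n → ℕ
  p : ℕ
  U : FreeGroup (Fin n)
  V : FreeGroup (Fin n)

namespace FTypeBase

/-- Relators of the full F-type presentation. -/
def rels (D : FTypeBase) : Set (FreeGroup (Fin D.n)) :=
  {w | ∃ i : Fin D.n, w = FreeGroup.of i ^ D.e i} ∪ {D.U * D.V}

/-- Relators presenting the first factor `G₁` (the generators `a_{p+1}, …, a_n` are killed), so
that `PresentedGroup D.rels1` is the free product of cyclics on `a_1, …, a_p`. -/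
def rels1 (D : FTypeBase) : Set (FreeGroup (Fin D.n)) :=
  {w | ∃ i : Fin D.n, (i : ℕ) < D.p ∧ w = FreeGroup.of i ^ D.e i} ∪
    {w | ∃ i : Fin D.n, D.p ≤ (i : ℕ) ∧ w = FreeGroup.of i}

/-- Relators presenting the second factor `G₂` (the generators `a_1, …, a_p` are killed), so
that `PresentedGroup D.rels2` is the free product of cyclics on `a_{p+1}, …, a_n`. -/
def rels2 (D : FTypeBase) : Set (FreeGroup (Fin D.n)) :=
  {w | ∃ i : Fin D.n, D.p ≤ (i : ℕ) ∧ w = FreeGroup.of i ^ D.e i} ∪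
    {w | ∃ i : Fin D.n, (i : ℕ) < D.p ∧ w = FreeGroup.of i}

/-- The group presented by the F-type presentation. -/
abbrev Gp (D : FTypeBase) := PresentedGroup D.rels

/-- The first factor `G₁ = ⟨a_1, …, a_p ∣ a_1^{e_1} = ⋯ = a_p^{e_p} = 1⟩`. -/
abbrev Gp1 (D : FTypeBase) := PresentedGroup D.rels1

/-- The second factor `G₂ = ⟨a_{p+1}, …, a_n ∣ a_{p+1}^{e_{p+1}} = ⋯ = a_n^{e_n} = 1⟩`. -/
abbrev Gp2 (D : FTypeBase) := PresentedGroup D.rels2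

/-- The image of the word `U` in the first factor `G₁`. -/
def imgU1 (D : FTypeBase) : D.Gp1 := PresentedGroup.mk D.rels1 D.U

/-- The image of the word `V` in the second factor `G₂`. -/
def imgV2 (D : FTypeBase) : D.Gp2 := PresentedGroup.mk D.rels2 D.V

/-- The conditions making an F-type presentation: `n ≥ 2`; each `e_i` is `0` or `≥ 2`;
`1 ≤ p ≤ n - 1`; `U` is a cyclically reduced word in `a_1, …, a_p` of infinite order in `G₁`;
`V` is a cyclically reduced word in `a_{p+1}, …, a_n` of infinite order in `G₂`; and if
`p = 1` (resp. `p = n - 1`) then `U = a_1^m` (resp. `V = a_n^m`) for some `m ≥ 2`. -/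
def IsFType (D : FTypeBase) : Prop :=
  2 ≤ D.n ∧ (∀ i, D.e i = 0 ∨ 2 ≤ D.e i) ∧ 1 ≤ D.p ∧ D.p ≤ D.n - 1 ∧
  (∀ x ∈ D.U.toWord, (x.1 : ℕ) < D.p) ∧ (∀ x ∈ D.V.toWord, D.p ≤ (x.1 : ℕ)) ∧
  CyclicallyReduced D.U ∧ CyclicallyReduced D.V ∧
  ¬ IsOfFinOrder D.imgU1 ∧ ¬ IsOfFinOrder D.imgV2 ∧
  (D.p = 1 → ∃ (i : Fin D.n) (m : ℕ), (i : ℕ) = 0 ∧ 2 ≤ m ∧ D.U = FreeGroup.of i ^ m) ∧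
  (D.p = D.n - 1 → ∃ (i : Fin D.n) (m : ℕ), (i : ℕ) = D.n - 1 ∧ 2 ≤ m ∧ D.V = FreeGroup.of i ^ m)

/-- The subgroup of the F-type group generated by (the images of) `a_1, …, a_p`. -/
def factor1 (D : FTypeBase) : Subgroup D.Gp :=
  Subgroup.closure {g | ∃ i : Fin D.n, (i : ℕ) < D.p ∧ g = PresentedGroup.of i}

/-- The subgroup of the F-type group generated by (the images of) `a_{p+1}, …, a_n`. -/
def factor2 (D : FTypeBase) : Subgroup D.Gp :=
  Subgroup.closure {g | ∃ i : Fin D.n, D.p ≤ (i : ℕ) ∧ g = PresentedGroup.of i}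

/-- The amalgamated subgroup `A = ⟨U⟩ = ⟨V⟩` of the F-type group. -/
def amalg (D : FTypeBase) : Subgroup D.Gp :=
  Subgroup.zpowers (PresentedGroup.mk D.rels D.U)

end FTypeBase

/-- A group is *of F-type* if it is isomorphic to the group of some F-type presentation. -/
def IsFTypeGroup (G : Type*) [Group G] : Prop :=
  ∃ D : FTypeBase, D.IsFType ∧ Nonempty (G ≃* D.Gp)

/-- An element of a group is a *proper power* if it equals `h ^ k` for some `k ≥ 2`. -/
def IsProperPower {G : Type*} [Group G] (g : G) : Prop :=
  ∃ (h : G) (k : ℕ), 2 ≤ k ∧ g = h ^ k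

/-- A group is a *free product of cyclic groups* if it has a presentation in which every
relator is a power of a generator. -/
def IsFreeProductOfCyclics (H : Type*) [Group H] : Prop :=
  ∃ (ι : Type) (e : ι → ℕ),
    Nonempty (H ≃* PresentedGroup {w : FreeGroup ι | ∃ i : ι, w = FreeGroup.of i ^ e i})

/-- A subgroup `K` of `H` is *malnormal* if `g K g⁻¹ ∩ K = {1}` for every `g ∉ K`. -/
def IsMalnormal {H : Type*} [Group H] (K : Subgroup H) : Prop :=
  ∀ g : H, g ∉ K → ∀ x ∈ K, g * x * g⁻¹ ∈ K → x = 1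

end FPaper

namespace FPaper

/-- A group `H` is *SQ-universal* if every countable group embeds in some quotient of `H`. -/
def SQUniversal (H : Type*) [Group H] : Prop :=
  ∀ (C : Type) (_ : Group C), Countable C →
    ∃ (N : Subgroup H) (_ : N.Normal) (f : C →* H ⧸ N), Function.Injective f

end FPaper

namespace NormalGeneration

open Equiv

variable {Ω I J : Type*}

/-- `σ` exchanges `i a` with `j a` for every `a` and fixes every other point. -/
def IsExchange (σ : Perm Ω) (i j : I → Ω) : Prop :=
  (∀ a, σ (i a) = j a) ∧ (∀ a, σ (j a) = i a) ∧
    ∀ x, x ∉ Set.range i → x ∉ Set.range j → σ x = x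

theorem IsExchange.symm {σ : Perm Ω} {i j : I → Ω} (h : IsExchange σ i j) : IsExchange σ j i :=
  ⟨h.2.1, h.1, fun x hx hy => h.2.2 x hy hx⟩

theorem IsExchange.comp {σ : Perm Ω} {i j : I → Ω} (h : IsExchange σ i j) (e : J ≃ I) :
    IsExchange σ (i ∘ e) (j ∘ e) :=
  ⟨fun a => h.1 _, fun a => h.2.1 _, fun x hx hy => h.2.2 x
    (by rwa [EquivLike.range_comp] at hx) (by rwa [EquivLike.range_comp] at hy)⟩

theorem IsExchange.unique {σ τ : Perm Ω} {i j : I → Ω} (h : IsExchange σ i j)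
    (h' : IsExchange τ i j) : σ = τ := by
  ext x
  by_cases hi : x ∈ Set.range i
  · obtain ⟨a, rfl⟩ := hi
    rw [h.1, h'.1]
  by_cases hj : x ∈ Set.range j
  · obtain ⟨a, rfl⟩ := hj
    rw [h.2.1, h'.2.1]
  rw [h.2.2 x hi hj, h'.2.2 x hi hj]

theorem IsExchange.conj {σ : Perm Ω} {i j : I → Ω} (h : IsExchange σ i j) (γ : Perm Ω) :
    IsExchange (γ * σ * γ⁻¹) (γ ∘ i) (γ ∘ j) := by
  refine ⟨fun a => by simp [h.1], fun a => by simp [h.2.1], fun x hx hy => ?_⟩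
  have : σ (γ⁻¹ x) = γ⁻¹ x := by
    refine h.2.2 _ ?_ ?_
    · rintro ⟨a, ha⟩
      exact hx ⟨a, by simp [ha]⟩
    · rintro ⟨a, ha⟩
      exact hy ⟨a, by simp [ha]⟩
  have e : (γ * σ * γ⁻¹) x = γ (σ (γ⁻¹ x)) := rfl
  rw [e, this]
  exact γ.apply_symm_apply x

theorem exists_isExchange {i j : I → Ω} (hi : i.Injective) (hj : j.Injective)
    (hij : ∀ a b, i a ≠ j b) : ∃ σ : Perm Ω, IsExchange σ i j := by
  classical
  let f : I ⊕ I ↪ Ω := ⟨Sum.elim i j, hi.sumElim hj hij⟩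
  refine ⟨Perm.viaEmbedding (Equiv.sumComm I I) f, fun a => ?_, fun a => ?_,
    fun x hx hy => ?_⟩
  · exact Perm.viaEmbedding_apply _ f (Sum.inl a)
  · exact Perm.viaEmbedding_apply _ f (Sum.inr a)
  · refine Perm.viaEmbedding_apply_of_notMem _ f x ?_
    rintro ⟨a | a, rfl⟩
    · exact hx ⟨a, rfl⟩
    · exact hy ⟨a, rfl⟩

/-- A subgroup `N` is normalised by a subgroup `E`. -/
def NormalisedBy {Γ : Type*} [Group Γ] (N E : Subgroup Γ) : Prop :=
  ∀ x ∈ N, ∀ e ∈ E, e * x * e⁻¹ ∈ N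

theorem NormalisedBy.conj_inv {Γ : Type*} [Group Γ] {N E : Subgroup Γ} (h : NormalisedBy N E)
    {x e : Γ} (hx : x ∈ N) (he : e ∈ E) : e⁻¹ * x * e ∈ N := by
  simpa using h x hx e⁻¹ (inv_mem he)

/-- Two exchanges that share one of their sides are conjugate by each other's product. -/
theorem IsExchange.mem_of_mem {N E : Subgroup (Perm Ω)} (hN : NormalisedBy N E)
    (hNE : N ≤ E) {σ ρ : Perm Ω} {i j k : I → Ω} (hσ : IsExchange σ i j) (hρ : IsExchange ρ j k)
    (hij : ∀ a b, i a ≠ j b) (hjk : ∀ a b, j a ≠ k b) (hik : ∀ a b, i a ≠ k b)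
    (hmem : σ ∈ N) (hE : ρ ∈ E) : ρ ∈ N := by
  have h1 : IsExchange (ρ * σ * ρ⁻¹) i k := by
    have := hσ.conj ρ
    have e1 : ρ ∘ i = i := by
      funext a
      refine hρ.2.2 _ ?_ ?_
      · rintro ⟨b, hb⟩; exact hij _ _ hb.symm
      · rintro ⟨b, hb⟩; exact hik _ _ hb.symm
    have e2 : ρ ∘ j = k := by funext a; exact hρ.1 a
    rwa [e1, e2] at this
  have h2 : IsExchange (σ * ρ * σ⁻¹) i k := by
    have := hρ.conj σ
    have e1 : σ ∘ k = k := by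
      funext a
      refine hσ.2.2 _ ?_ ?_
      · rintro ⟨b, hb⟩; exact hik _ _ hb
      · rintro ⟨b, hb⟩; exact hjk _ _ hb
    have e2 : σ ∘ j = i := by funext a; exact hσ.2.1 a
    rwa [e1, e2] at this
  have h3 := h1.unique h2
  have h4 : ρ = σ⁻¹ * (ρ * σ * ρ⁻¹) * σ := by rw [h3]; group
  rw [h4]
  exact hN.conj_inv (hN _ hmem _ hE) (hNE hmem)

section Construction

variable (C : Type)

/-- The base set of the construction. -/
abbrev Base := C × ℤ × ℤ × ℕ

/-- Three copies of the base set. -/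
abbrev Triple := Σ _ : Fin 3, Base C

variable {C}

/-- The inclusion of the `k`-th copy. -/
abbrev copy (k : Fin 3) (y : Base C) : Triple C := ⟨k, y⟩

theorem copy_ne {k l : Fin 3} (h : k ≠ l) (a b : Base C) : copy k a ≠ copy l b :=
  fun e => h (congrArg Sigma.fst e)

/-- Translation of the third coordinate. -/
def shift (k : ℤ) : Perm (Base C) where
  toFun y := (y.1, y.2.1, y.2.2.1 + k, y.2.2.2)
  invFun y := (y.1, y.2.1, y.2.2.1 - k, y.2.2.2)
  left_inv y := by simp
  right_inv y := by simp

theorem shift_zpow (k : ℤ) : (shift 1 : Perm (Base C)) ^ k = shift k := by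
  have h (a b : ℤ) : (shift a * shift b : Perm (Base C)) = shift (a + b) := by
    refine Equiv.ext fun y => ?_
    simp [shift, add_comm, add_left_comm]
  have h0 : (shift 0 : Perm (Base C)) = 1 := by ext y <;> simp [shift]
  let f : Multiplicative ℤ →* Perm (Base C) :=
    { toFun := fun a => shift a.toAdd, map_one' := h0, map_mul' := fun a b => (h _ _).symm }
  have := map_zpow f (Multiplicative.ofAdd 1) k
  rw [← ofAdd_zsmul] at this
  simpa [f] using this.symm

/-- The coordinatewise action of three permutations of the base. -/
abbrev diag : (Fin 3 → Perm (Base C)) →* Perm (Triple C) :=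
  Perm.sigmaCongrRightHom (fun _ : Fin 3 => Base C)

theorem mul_eq_diag_first {σ τ : Perm (Triple C)} {φ : Perm (Base C)}
    (hσ : IsExchange σ (copy 0) (copy 1)) (hτ : IsExchange τ (copy 0) (copy 1 ∘ φ)) :
    σ * τ = diag ![φ, φ⁻¹, 1] := by
  refine Equiv.ext fun ⟨k, y⟩ => ?_
  fin_cases k
  · exact (congrArg σ (hτ.1 y)).trans (hσ.2.1 _)
  · have := hτ.2.1 (φ⁻¹ y)
    rw [Function.comp, show φ (φ⁻¹ y) = y from φ.apply_symm_apply y] at this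
    exact (congrArg σ this).trans (hσ.1 _)
  · have h1 : τ (copy 2 y) = copy 2 y := hτ.2.2 _ (by rintro ⟨a, h⟩; exact copy_ne (by decide) _ _ h)
      (by rintro ⟨a, h⟩; exact copy_ne (by decide) _ _ h)
    have h2 : σ (copy 2 y) = copy 2 y := hσ.2.2 _ (by rintro ⟨a, h⟩; exact copy_ne (by decide) _ _ h)
      (by rintro ⟨a, h⟩; exact copy_ne (by decide) _ _ h)
    exact (congrArg σ h1).trans h2

theorem mul_eq_diag_second {σ τ : Perm (Triple C)} {φ : Perm (Base C)}
    (hσ : IsExchange σ (copy 0) (copy 2)) (hτ : IsExchange τ (copy 0) (copy 2 ∘ φ)) :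
    σ * τ = diag ![φ, 1, φ⁻¹] := by
  refine Equiv.ext fun ⟨k, y⟩ => ?_
  fin_cases k
  · exact (congrArg σ (hτ.1 y)).trans (hσ.2.1 _)
  · have h1 : τ (copy 1 y) = copy 1 y := hτ.2.2 _ (by rintro ⟨a, h⟩; exact copy_ne (by decide) _ _ h)
      (by rintro ⟨a, h⟩; exact copy_ne (by decide) _ _ h)
    have h2 : σ (copy 1 y) = copy 1 y := hσ.2.2 _ (by rintro ⟨a, h⟩; exact copy_ne (by decide) _ _ h)
      (by rintro ⟨a, h⟩; exact copy_ne (by decide) _ _ h)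
    exact (congrArg σ h1).trans h2
  · have := hτ.2.1 (φ⁻¹ y)
    rw [Function.comp, show φ (φ⁻¹ y) = y from φ.apply_symm_apply y] at this
    exact (congrArg σ this).trans (hσ.1 _)

variable [Group C]

/-- Multiplication by `en i` in the first coordinate on the half where the second coordinate is
nonnegative. -/
def halfMul (en : ℤ → C) : Perm (Base C) where
  toFun y := (if 0 ≤ y.2.1 then en y.2.2.1 * y.1 else y.1, y.2)
  invFun y := (if 0 ≤ y.2.1 then (en y.2.2.1)⁻¹ * y.1 else y.1, y.2)
  left_inv y := by by_cases h : 0 ≤ y.2.1 <;> simp [h]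
  right_inv y := by by_cases h : 0 ≤ y.2.1 <;> simp [h]

/-- Translation of the second coordinate on the slice where the third coordinate vanishes. -/
def sliceShift : Perm (Base C) where
  toFun y := (y.1, if y.2.2.1 = 0 then y.2.1 + 1 else y.2.1, y.2.2)
  invFun y := (y.1, if y.2.2.1 = 0 then y.2.1 - 1 else y.2.1, y.2.2)
  left_inv y := by by_cases h : y.2.2.1 = 0 <;> simp [h]
  right_inv y := by by_cases h : y.2.2.1 = 0 <;> simp [h]

/-- Left multiplication by `g` in the first coordinate where the second and third vanish. -/
def localMul : C →* Perm (Base C) where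
  toFun g :=
    { toFun := fun y => (if y.2.1 = 0 ∧ y.2.2.1 = 0 then g * y.1 else y.1, y.2)
      invFun := fun y => (if y.2.1 = 0 ∧ y.2.2.1 = 0 then g⁻¹ * y.1 else y.1, y.2)
      left_inv := fun y => by by_cases h : y.2.1 = 0 ∧ y.2.2.1 = 0 <;> simp [h]
      right_inv := fun y => by by_cases h : y.2.1 = 0 ∧ y.2.2.1 = 0 <;> simp [h] }
  map_one' := by ext y <;> simp
  map_mul' g h := by
    ext y
    · by_cases h : y.2.1 = 0 ∧ y.2.2.1 = 0 <;> simp [h, mul_assoc]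
    all_goals simp

theorem commutator_eq_localMul (en : ℤ → C) (i : ℤ) :
    (shift i)⁻¹ * halfMul en * shift i * sliceShift * ((shift i)⁻¹ * halfMul en * shift i)⁻¹ *
      sliceShift⁻¹ = localMul (en i) := by
  rw [mul_inv_eq_iff_eq_mul, mul_inv_eq_iff_eq_mul]
  refine Equiv.ext fun ⟨x, n, j, q⟩ => ?_
  have e (y : Base C) : (shift i : Perm (Base C))⁻¹ y = (y.1, y.2.1, y.2.2.1 - i, y.2.2.2) := rfl
  have e2 (y : Base C) : (shift i : Perm (Base C)) y = (y.1, y.2.1, y.2.2.1 + i, y.2.2.2) := rfl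
  simp only [Perm.mul_apply, e, e2]
  by_cases hj : j = 0
  · subst hj
    rcases lt_trichotomy n (-1) with hn | rfl | hn
    · have h1 : ¬ (0 ≤ n) := by omega
      have h2 : ¬ (0 ≤ n + 1) := by omega
      have h3 : ¬ (n + 1 = 0) := by omega
      simp [sliceShift, halfMul, localMul, h1, h2, h3]
    · simp [sliceShift, halfMul, localMul]
    · have h1 : (0 ≤ n) := by omega
      have h2 : (0 ≤ n + 1) := by omega
      have h3 : ¬ (n + 1 = 0) := by omega
      simp [sliceShift, halfMul, localMul, h1, h2, h3]
  · by_cases hn : 0 ≤ n <;> simp [sliceShift, halfMul, localMul, hj, hn]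

/-- The embedding of `C` in the permutations of the triple. -/
def embed : C →* Perm (Triple C) :=
  (diag.comp (MonoidHom.mulSingle (fun _ : Fin 3 => Perm (Base C)) 0)).comp localMul

theorem embed_eq (g : C) : embed g = diag ![localMul g, 1, 1] := by
  simp only [embed, MonoidHom.comp_apply]
  congr 1
  funext k
  fin_cases k <;> rfl

theorem embed_apply_zero (g : C) (m : ℕ) :
    embed g (copy 0 (1, 0, 0, m)) = copy 0 (g, 0, 0, m) := by
  rw [embed_eq]
  change copy 0 (localMul g (1, 0, 0, m)) = _
  simp [localMul]

theorem embed_injective : Function.Injective (embed : C →* Perm (Triple C)) := by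
  intro g h hgh
  have h1 := embed_apply_zero g 0
  rw [hgh, embed_apply_zero] at h1
  simpa using h1.symm

theorem embed_eq_commutator (en : ℤ → C) (i : ℤ) :
    (diag ![shift 1, (shift 1)⁻¹, 1] ^ i)⁻¹ * diag ![halfMul en, (halfMul en)⁻¹, 1] *
      diag ![shift 1, (shift 1)⁻¹, 1] ^ i * diag ![sliceShift, 1, sliceShift⁻¹] *
      ((diag ![shift 1, (shift 1)⁻¹, 1] ^ i)⁻¹ * diag ![halfMul en, (halfMul en)⁻¹, 1] *
      diag ![shift 1, (shift 1)⁻¹, 1] ^ i)⁻¹ * (diag ![sliceShift, 1, sliceShift⁻¹])⁻¹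
      = embed (en i) := by
  rw [embed_eq, ← commutator_eq_localMul]
  simp only [← map_mul, ← map_inv, ← map_zpow]
  congr 1
  funext k
  fin_cases k
  · simp [shift_zpow]
  · simp
  · simp

end Construction

theorem IsExchange.inv {Ω I : Type*} {σ : Perm Ω} {i j : I → Ω} (h : IsExchange σ i j) :
    IsExchange σ⁻¹ i j :=
  ⟨fun a => σ.symm_apply_eq.2 (h.2.1 a).symm, fun a => σ.symm_apply_eq.2 (h.1 a).symm,
    fun x hx hy => σ.symm_apply_eq.2 (h.2.2 x hx hy).symm⟩

theorem IsExchange.mul {Ω I J : Type*} {σ τ : Perm Ω} {i j : I → Ω} {k l : J → Ω}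
    (hσ : IsExchange σ i j) (hτ : IsExchange τ k l) (hik : ∀ a b, i a ≠ k b)
    (hil : ∀ a b, i a ≠ l b) (hjk : ∀ a b, j a ≠ k b) (hjl : ∀ a b, j a ≠ l b) :
    IsExchange (σ * τ) (Sum.elim i k) (Sum.elim j l) := by
  have h1 (a) : τ (i a) = i a := hτ.2.2 _ (by rintro ⟨b, h⟩; exact hik _ _ h.symm)
    (by rintro ⟨b, h⟩; exact hil _ _ h.symm)
  have h2 (a) : τ (j a) = j a := hτ.2.2 _ (by rintro ⟨b, h⟩; exact hjk _ _ h.symm)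
    (by rintro ⟨b, h⟩; exact hjl _ _ h.symm)
  have h3 (b) : σ (k b) = k b := hσ.2.2 _ (by rintro ⟨a, h⟩; exact hik _ _ h)
    (by rintro ⟨a, h⟩; exact hjk _ _ h)
  have h4 (b) : σ (l b) = l b := hσ.2.2 _ (by rintro ⟨a, h⟩; exact hil _ _ h)
    (by rintro ⟨a, h⟩; exact hjl _ _ h)
  refine ⟨?_, ?_, fun x hx hy => ?_⟩
  · rintro (a | a)
    · simp [h1, hσ.1]
    · simp [hτ.1, h4]
  · rintro (a | a)
    · simp [h2, hσ.2.1]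
    · simp [hτ.2.1, h3]
  · rw [Set.Sum.elim_range, Set.mem_union, not_or] at hx hy
    rw [Perm.mul_apply, hτ.2.2 x hx.2 hy.2, hσ.2.2 x hx.1 hy.1]

/-- The standard points of the zeroth copy, indexed by `Bool × Bool × ℕ`. -/
noncomputable def point (C : Type) [Group C] (x : Bool × Bool × ℕ) : Triple C :=
  copy 0 (1, 0, 0, (nonempty_equiv_of_countable (α := Bool × Bool × ℕ) (β := ℕ)).some x)

theorem point_injective (C : Type) [Group C] : Function.Injective (point C) := by
  intro x y h
  have h1 := eq_of_heq (Sigma.mk.inj h).2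
  simpa using h1

theorem embed_point_notMem {C : Type} [Group C] {g : C} (hg : g ≠ 1) (x y : Bool × Bool × ℕ) :
    embed g (point C x) ≠ point C y := by
  intro h
  rw [point, embed_apply_zero] at h
  have h1 := congrArg Prod.fst (eq_of_heq (Sigma.mk.inj h).2)
  exact hg h1

/-- Every countable group embeds in a finitely generated group in which each nontrivial element of
the image is a normal generator. -/
theorem exists_fg_normally_generated (C : Type) [Group C] [Countable C] :
    ∃ (E : Type) (_ : Group E) (ι : C →* E), Group.FG E ∧ Function.Injective ι ∧
      ∀ N : Subgroup E, N.Normal → ∀ g : C, g ≠ 1 → ι g ∈ N → N = ⊤ := by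
  classical
  obtain ⟨en, hen⟩ : ∃ en : ℤ → C, Function.Surjective en := by
    obtain ⟨f, hf⟩ := exists_surjective_nat C
    exact ⟨fun z => f z.toNat, fun c => by
      obtain ⟨n, rfl⟩ := hf c
      exact ⟨n, by simp⟩⟩
  let e1 : ℕ ≃ Base C := (nonempty_equiv_of_countable (α := ℕ) (β := Base C)).some
  let e2 : Bool × ℕ ≃ Base C := (nonempty_equiv_of_countable (α := Bool × ℕ) (β := Base C)).some
  have copyInj (k : Fin 3) : Function.Injective (copy k : Base C → Triple C) :=
    fun a b h => eq_of_heq (Sigma.mk.inj h).2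
  have swap (k l : Fin 3) (hkl : k ≠ l) (φ : Perm (Base C)) :
      ∃ σ, IsExchange σ (copy k) (copy l ∘ φ) :=
    exists_isExchange (copyInj k) ((copyInj l).comp φ.injective) fun a b => copy_ne hkl _ _
  obtain ⟨A₀, hA₀⟩ := swap 0 1 (by decide) 1
  obtain ⟨As, hAs⟩ := swap 0 1 (by decide) (halfMul en)
  obtain ⟨At, hAt⟩ := swap 0 1 (by decide) (shift 1)
  obtain ⟨B₀, hB₀⟩ := swap 0 2 (by decide) 1
  obtain ⟨Bu, hBu⟩ := swap 0 2 (by decide) sliceShift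
  have pinj {J : Type} {f : J → Bool × Bool × ℕ} (hf : f.Injective) :
      Function.Injective (point C ∘ f) := (point_injective C).comp hf
  let z00 : ℕ → Triple C := point C ∘ fun m => (false, false, m)
  let z10 : ℕ → Triple C := point C ∘ fun m => (true, false, m)
  let zl0 : Bool × ℕ → Triple C := point C ∘ fun m => (m.1, false, m.2)
  let zl1 : Bool × ℕ → Triple C := point C ∘ fun m => (m.1, true, m.2)
  let z0 : Bool × ℕ → Triple C := point C ∘ fun m => (false, m.1, m.2)
  let z1 : Bool × ℕ → Triple C := point C ∘ fun m => (true, m.1, m.2)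
  have iz00 : z00.Injective := pinj fun a b h => by simpa using h
  have iz10 : z10.Injective := pinj fun a b h => by simpa using h
  have izl0 : zl0.Injective := pinj fun a b h => by simpa [Prod.ext_iff] using h
  have izl1 : zl1.Injective := pinj fun a b h => by simpa [Prod.ext_iff] using h
  have iz0 : z0.Injective := pinj fun a b h => by simpa [Prod.ext_iff] using h
  have iz1 : z1.Injective := pinj fun a b h => by simpa [Prod.ext_iff] using h
  have d0 (a b) : z00 a ≠ z10 b := fun h => by simpa using point_injective C h
  have dl (a b) : zl0 a ≠ zl1 b := fun h => by simpa using point_injective C h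
  have d1 (a b) : z0 a ≠ z1 b := fun h => by simpa using point_injective C h
  have dcopy {k : Fin 3} (hk : k ≠ 0) (x) (y : Base C) : point C x ≠ copy k y :=
    copy_ne hk.symm _ _
  obtain ⟨α, hα⟩ := exists_isExchange iz00 iz10 d0
  obtain ⟨α', hα'⟩ := exists_isExchange izl0 izl1 dl
  obtain ⟨lα, hlα⟩ := exists_isExchange iz10 ((copyInj 1).comp e1.injective)
    fun a b => dcopy (by decide) _ _
  obtain ⟨lα', hlα'⟩ := exists_isExchange izl1 ((copyInj 1).comp e2.injective)
    fun a b => dcopy (by decide) _ _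
  obtain ⟨lβ, hlβ⟩ := exists_isExchange iz1 ((copyInj 1).comp e2.injective)
    fun a b => dcopy (by decide) _ _
  let gens : Set (Perm (Triple C)) := {A₀, As, At, B₀, Bu, α, α', lα, lα', lβ}
  have hfin : gens.Finite := by simp [gens]
  let E : Subgroup (Perm (Triple C)) := Subgroup.closure gens
  have hgen {x} (hx : x ∈ gens) : x ∈ E := Subgroup.subset_closure hx
  have hι (c : C) : embed c ∈ E := by
    obtain ⟨i, rfl⟩ := hen c
    have hs : diag ![halfMul en, (halfMul en)⁻¹, 1] ∈ E := by
      rw [← mul_eq_diag_first hA₀ hAs]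
      exact mul_mem (hgen (by simp [gens])) (hgen (by simp [gens]))
    have ht : diag ![shift 1, (shift 1)⁻¹, 1] ∈ E := by
      rw [← mul_eq_diag_first hA₀ hAt]
      exact mul_mem (hgen (by simp [gens])) (hgen (by simp [gens]))
    have hu : diag ![sliceShift, 1, sliceShift⁻¹] ∈ E := by
      rw [← mul_eq_diag_second hB₀ hBu]
      exact mul_mem (hgen (by simp [gens])) (hgen (by simp [gens]))
    rw [← embed_eq_commutator]
    have hz := E.zpow_mem ht i
    have hc := E.mul_mem (E.mul_mem (E.inv_mem hz) hs) hz
    exact E.mul_mem (E.mul_mem (E.mul_mem hc hu) (E.inv_mem hc)) (E.inv_mem hu)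
  have key (N : Subgroup (Perm (Triple C))) (hNE : N ≤ E) (hN : NormalisedBy N E) (g : C)
      (hg : g ≠ 1) (hgN : embed g ∈ N) : E ≤ N := by
    set γ : Perm (Triple C) := embed g with hγ
    have hα2 : IsExchange (α' * α * α'⁻¹) (α' ∘ z00) (α' ∘ z10) := hα.conj α'
    have hβ : IsExchange (α * (α' * α * α'⁻¹)⁻¹) z0 z1 := by
      have e0 : α' ∘ z00 = zl1 ∘ fun m => (false, m) := by
        funext m; exact hα'.1 (false, m)
      have e1 : α' ∘ z10 = zl1 ∘ fun m => (true, m) := by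
        funext m; exact hα'.1 (true, m)
      rw [e0, e1] at hα2
      have h := (hα.mul hα2.inv
        (fun a b h => by simpa using point_injective C h)
        (fun a b h => by simpa using point_injective C h)
        (fun a b h => by simpa using point_injective C h)
        (fun a b h => by simpa using point_injective C h)).comp (boolProdEquivSum ℕ)
      convert h using 1
      · funext ⟨b, m⟩; cases b <;> rfl
      · funext ⟨b, m⟩; cases b <;> rfl
    have hcomm : (γ * α * γ⁻¹) * α' = α' * (γ * α * γ⁻¹) := by
      refine Perm.Disjoint.commute fun x => ?_
      by_cases hx : x ∈ Set.range (point C)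
      · left
        have hx' (y) : γ⁻¹ x ≠ point C y := by
          obtain ⟨w, rfl⟩ := hx
          rw [hγ, ← map_inv]
          exact embed_point_notMem (inv_ne_one.2 hg) _ _
        have : α (γ⁻¹ x) = γ⁻¹ x := hα.2.2 _ (by rintro ⟨a, h⟩; exact hx' _ h.symm)
          (by rintro ⟨a, h⟩; exact hx' _ h.symm)
        have e : (γ * α * γ⁻¹) x = γ (α (γ⁻¹ x)) := rfl
        rw [e, this]
        exact γ.apply_symm_apply x
      · right
        exact hα'.2.2 _ (by rintro ⟨a, h⟩; exact hx ⟨_, h⟩) (by rintro ⟨a, h⟩; exact hx ⟨_, h⟩)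
    have hαE : α ∈ E := hgen (by simp [gens])
    have hα'E : α' ∈ E := hgen (by simp [gens])
    have hβN : α * (α' * α * α'⁻¹)⁻¹ ∈ N := by
      have hε : α * γ * α⁻¹ * γ⁻¹ ∈ N := mul_mem (hN _ hgN _ hαE) (inv_mem hgN)
      have h2 : (α * γ * α⁻¹ * γ⁻¹) * (α' * (α * γ * α⁻¹ * γ⁻¹)⁻¹ * α'⁻¹) ∈ N :=
        mul_mem hε (hN _ (inv_mem hε) _ hα'E)
      convert h2 using 1
      have hc2 : (γ * α * γ⁻¹)⁻¹ * α' * (γ * α * γ⁻¹) = α' := by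
        rw [mul_assoc, ← hcomm]; group
      have : (α * γ * α⁻¹ * γ⁻¹) * (α' * (α * γ * α⁻¹ * γ⁻¹)⁻¹ * α'⁻¹)
          = α * ((γ * α * γ⁻¹)⁻¹ * α' * (γ * α * γ⁻¹)) * α⁻¹ * α'⁻¹ := by group
      rw [this, hc2]
      group
    have link {I : Type} {σ ρ : Perm (Triple C)} {i j k : I → Triple C}
        (hσ : IsExchange σ i j) (hρ : IsExchange ρ j k) (hij : ∀ a b, i a ≠ j b)
        (hjk : ∀ a b, j a ≠ k b) (hik : ∀ a b, i a ≠ k b) (hmem : σ ∈ N) (hE : ρ ∈ gens) :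
        ρ ∈ N := hσ.mem_of_mem hN hNE hρ hij hjk hik hmem (hgen hE)
    have hlβN : lβ ∈ N := link hβ hlβ d1 (fun a b => dcopy (by decide) _ _)
      (fun a b => dcopy (by decide) _ _) hβN (by simp [gens])
    have hM : IsExchange (B₀ * A₀ * B₀⁻¹) (copy 2) (copy 1) := by
      have h := hA₀.conj B₀
      have e1 : B₀ ∘ copy 0 = copy 2 := by funext a; exact hB₀.1 a
      have e2 : B₀ ∘ (copy 1 ∘ (1 : Perm (Base C))) = copy 1 := by
        funext a
        exact hB₀.2.2 _ (by rintro ⟨b, h⟩; exact copy_ne (by decide) _ _ h)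
          (by rintro ⟨b, h⟩; exact copy_ne (by decide) _ _ h)
      rwa [e1, e2] at h
    have hME : B₀ * A₀ * B₀⁻¹ ∈ E := by
      have hB : B₀ ∈ E := hgen (by simp [gens])
      have hA : A₀ ∈ E := hgen (by simp [gens])
      exact mul_mem (mul_mem hB hA) (inv_mem hB)
    have hMN : B₀ * A₀ * B₀⁻¹ ∈ N :=
      hlβ.mem_of_mem hN hNE (hM.comp e2).symm (fun a b => dcopy (by decide) _ _)
        (fun a b => copy_ne (by decide) _ _) (fun a b => dcopy (by decide) _ _) hlβN hME
    have first {σ : Perm (Triple C)} {φ : Perm (Base C)}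
        (h : IsExchange σ (copy 0) (copy 1 ∘ φ)) (hσ : σ ∈ gens) : σ ∈ N :=
      link (hM.comp φ) h.symm (fun a b => copy_ne (by decide) _ _)
        (fun a b => copy_ne (by decide) _ _) (fun a b => copy_ne (by decide) _ _) hMN hσ
    have second {σ : Perm (Triple C)} {φ : Perm (Base C)}
        (h : IsExchange σ (copy 0) (copy 2 ∘ φ)) (hσ : σ ∈ gens) : σ ∈ N :=
      link (hM.comp φ).symm h.symm (fun a b => copy_ne (by decide) _ _)
        (fun a b => copy_ne (by decide) _ _) (fun a b => copy_ne (by decide) _ _) hMN hσ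
    have hlαN : lα ∈ N := link (hM.comp e1) hlα.symm (fun a b => copy_ne (by decide) _ _)
      (fun a b => (dcopy (by decide) _ _).symm) (fun a b => (dcopy (by decide) _ _).symm) hMN
      (by simp [gens])
    have hlα'N : lα' ∈ N := link (hM.comp e2) hlα'.symm (fun a b => copy_ne (by decide) _ _)
      (fun a b => (dcopy (by decide) _ _).symm) (fun a b => (dcopy (by decide) _ _).symm) hMN
      (by simp [gens])
    have hαN : α ∈ N := link hlα.symm hα.symm (fun a b => (dcopy (by decide) _ _).symm)
      (fun a b => (d0 _ _).symm) (fun a b => (dcopy (by decide) _ _).symm) hlαN (by simp [gens])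
    have hα'N : α' ∈ N := link hlα'.symm hα'.symm (fun a b => (dcopy (by decide) _ _).symm)
      (fun a b => (dl _ _).symm) (fun a b => (dcopy (by decide) _ _).symm) hlα'N (by simp [gens])
    refine (Subgroup.closure_le _).2 ?_
    have hA₀N := first hA₀ (by simp [gens])
    have hAsN := first hAs (by simp [gens])
    have hAtN := first hAt (by simp [gens])
    have hB₀N := second hB₀ (by simp [gens])
    have hBuN := second hBu (by simp [gens])
    rintro x (rfl | rfl | rfl | rfl | rfl | rfl | rfl | rfl | rfl | rfl) <;> assumption
  refine ⟨E, inferInstance, embed.codRestrict E hι, ?_, ?_, ?_⟩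
  · have : Finite gens := hfin
    exact (Group.fg_iff_subgroup_fg E).2 ⟨hfin.toFinset, by simp [E]⟩
  · intro a b h
    exact embed_injective (congrArg Subtype.val h)
  · intro N hN g hg hgN
    have hle : E ≤ N.map E.subtype := by
      refine key _ (Subgroup.map_subtype_le N) ?_ g hg ⟨_, hgN, rfl⟩
      rintro _ ⟨x, hx, rfl⟩ e he
      exact ⟨_, hN.conj_mem x hx ⟨e, he⟩, rfl⟩
    rw [eq_top_iff]
    intro x _
    obtain ⟨y, hy, hxy⟩ := hle x.2
    rwa [← Subtype.ext hxy]

end NormalGeneration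

/-- Every countable group embeds in a finitely generated infinite simple group. -/
theorem exists_fg_infinite_simple (C : Type) [Group C] [Countable C] :
    ∃ (S : Type) (_ : Group S) (ι : C →* S), Group.FG S ∧ Infinite S ∧ IsSimpleGroup S ∧
      Function.Injective ι := by
  have : Countable (Multiplicative ℤ) := inferInstanceAs (Countable ℤ)
  obtain ⟨E, _, ι, hfg, hι, hE⟩ :=
    NormalGeneration.exists_fg_normally_generated (C × Multiplicative ℤ)
  let g₀ : C × Multiplicative ℤ := (1, Multiplicative.ofAdd 1)
  have hg₀ : g₀ ≠ 1 := fun h => by simpa [g₀] using congrArg Prod.snd h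
  let 𝒩 : Set (Subgroup E) := {N | N.Normal ∧ ι g₀ ∉ N}
  have hbot : ⊥ ∈ 𝒩 := ⟨inferInstance, fun h => hg₀ (hι (by simpa using h))⟩
  obtain ⟨N, -, hN⟩ : ∃ N, ⊥ ≤ N ∧ Maximal (· ∈ 𝒩) N := by
    refine zorn_le_nonempty₀ 𝒩 (fun c hc hchain y hy => ⟨sSup c, ⟨?_, ?_⟩, fun z hz => le_sSup hz⟩)
      ⊥ hbot
    · refine ⟨fun x hx g => ?_⟩
      rw [Subgroup.mem_sSup_of_directedOn ⟨y, hy⟩ hchain.directedOn] at hx ⊢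
      obtain ⟨s, hs, hxs⟩ := hx
      exact ⟨s, hs, (hc hs).1.conj_mem x hxs g⟩
    · rw [Subgroup.mem_sSup_of_directedOn ⟨y, hy⟩ hchain.directedOn]
      rintro ⟨s, hs, hxs⟩
      exact (hc hs).2 hxs
  have := hN.1.1
  have hinj : Function.Injective ((QuotientGroup.mk' N).comp ι) := by
    rw [injective_iff_map_eq_one]
    intro g hg
    by_contra hne
    have h1 : ι g ∈ N := by simpa using hg
    have h2 := hE N hN.1.1 g hne h1
    exact hN.1.2 (h2 ▸ Subgroup.mem_top _)
  refine ⟨E ⧸ N, inferInstance,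
    ((QuotientGroup.mk' N).comp ι).comp (MonoidHom.inl C (Multiplicative ℤ)),
    Group.fg_of_surjective (QuotientGroup.mk'_surjective N), Infinite.of_injective _ hinj, ?_,
    hinj.comp fun a b h => (Prod.ext_iff.1 h).1⟩
  have : Nontrivial (E ⧸ N) :=
    ⟨⟨_, 1, fun h => hN.1.2 ((QuotientGroup.eq_one_iff (ι g₀)).1 h)⟩⟩
  refine ⟨fun K hK => ?_⟩
  have hle : N ≤ K.comap (QuotientGroup.mk' N) := by
    intro x hx
    have : (x : E ⧸ N) = 1 := (QuotientGroup.eq_one_iff x).2 hx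
    simp [this]
  by_cases hmem : ι g₀ ∈ K.comap (QuotientGroup.mk' N)
  · right
    have h := hE _ (hK.comap _) g₀ hg₀ hmem
    rw [eq_top_iff]
    intro x _
    obtain ⟨y, rfl⟩ := QuotientGroup.mk'_surjective N x
    exact (h ▸ Subgroup.mem_top y : y ∈ K.comap (QuotientGroup.mk' N))
  · left
    have h := hN.2 (⟨hK.comap _, hmem⟩ : K.comap (QuotientGroup.mk' N) ∈ 𝒩) hle
    rw [eq_bot_iff]
    intro x hx
    obtain ⟨y, rfl⟩ := QuotientGroup.mk'_surjective N x
    simpa using h hx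

/-- If a finite-index subgroup of `G` maps onto an infinite simple group `S`, then `S` embeds in a
quotient of `G`. -/
theorem exists_embedding_quotient_of_finiteIndex {G S : Type*} [Group G] [Group S] [Infinite S]
    [IsSimpleGroup S] (H : Subgroup G) [H.FiniteIndex] (f : H →* S) (hf : Function.Surjective f) :
    ∃ (N : Subgroup G) (_ : N.Normal) (ι : S →* G ⧸ N), Function.Injective ι := by
  classical
  let H₀ : Subgroup G := H.normalCore
  let f₀ : H₀ →* S := f.comp (Subgroup.inclusion H.normalCore_le)
  have dichotomy {L : Subgroup H₀} (hL : L.Normal) {φ : H₀ →* S} (hφ : Function.Surjective φ) :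
      L ≤ φ.ker ∨ ∀ s, ∃ x ∈ L, φ x = s := by
    rcases (hL.map φ hφ).eq_bot_or_eq_top with h | h
    · left
      rwa [← Subgroup.map_eq_bot_iff]
    · right
      intro s
      have : s ∈ L.map φ := h ▸ Subgroup.mem_top s
      simpa using this
  have hf₀ : Function.Surjective f₀ := by
    have hr : f₀.range = (H₀.subgroupOf H).map f := by
      ext s
      constructor
      · rintro ⟨x, rfl⟩
        exact ⟨⟨x, H.normalCore_le x.2⟩, x.2, rfl⟩
      · rintro ⟨x, hx, rfl⟩
        exact ⟨⟨x, hx⟩, rfl⟩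
    have hn : ((H₀.subgroupOf H).map f).Normal :=
      Subgroup.Normal.map inferInstance f hf
    rw [← MonoidHom.range_eq_top, hr]
    refine hn.eq_bot_or_eq_top.resolve_left fun h => ?_
    have h1 : ((H₀.subgroupOf H).map f).index ∣ (H₀.subgroupOf H).index :=
      Subgroup.index_map_dvd _ hf
    rw [h, Subgroup.index_bot, Nat.card_eq_zero_of_infinite, zero_dvd_iff] at h1
    exact Subgroup.FiniteIndex.index_ne_zero h1
  let c (g : G) : H₀ →* H₀ := (MulAut.conjNormal g : MulAut H₀).toMonoidHom
  let M (g : G) : Subgroup H₀ := (f₀.comp (c g)).ker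
  have hM (g : G) : Function.Surjective (f₀.comp (c g)) :=
    hf₀.comp (MulAut.conjNormal g : MulAut H₀).surjective
  have hMmul (h : H₀) (g : G) : M (h * g) = M g := by
    ext x
    have : c (h * g) x = h * c g x * h⁻¹ := by
      ext; simp [c, mul_assoc]
    simp [M, MonoidHom.mem_ker, this]
  let Q := G ⧸ H₀
  let R (q : Q) : Subgroup H₀ := M (q.out)⁻¹
  have hR (g : G) : ∃ q, R q = M g := by
    refine ⟨(g⁻¹ : G), ?_⟩
    obtain ⟨h, hh⟩ := QuotientGroup.mk_out_eq_mul H₀ g⁻¹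
    have : ((g⁻¹ : G) : Q).out⁻¹ = (h⁻¹ : H₀) * g := by
      rw [hh]; simp
    simp only [R, this, hMmul]
  have : Fintype Q := Fintype.ofFinite Q
  let 𝓘 : Set (Finset Q) := {I | ¬ (⨅ q ∈ I, R q) ≤ f₀.ker}
  have hempty : ∅ ∈ 𝓘 := by
    intro h
    simp only [Finset.notMem_empty, not_false_eq_true, iInf_neg, iInf_top, top_le_iff] at h
    obtain ⟨s, hs⟩ := exists_ne (1 : S)
    obtain ⟨x, rfl⟩ := hf₀ s
    exact hs (MonoidHom.mem_ker.1 (h ▸ Subgroup.mem_top x))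
  obtain ⟨I, hI⟩ := (Set.toFinite 𝓘).exists_maximal ⟨_, hempty⟩
  set L : Subgroup H₀ := ⨅ q ∈ I, R q with hLdef
  have hLn : L.Normal := by
    refine ⟨fun x hx g => ?_⟩
    simp only [hLdef, Subgroup.mem_iInf] at hx ⊢
    exact fun q hq => (inferInstance : (R q).Normal).conj_mem x (hx q hq) g
  have hLR (q : Q) : L ⊓ f₀.ker ≤ R q := by
    by_cases hq : q ∈ I
    · exact inf_le_left.trans (iInf₂_le q hq)
    have h1 : L ⊓ R q ≤ f₀.ker := by
      by_contra hne
      have h2 : insert q I ∈ 𝓘 := by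
        change ¬ _
        rw [Finset.iInf_insert, inf_comm]
        exact hne
      exact hq (hI.2 h2 (Finset.subset_insert q I) (Finset.mem_insert_self q I))
    have hn : (L ⊓ f₀.ker).Normal := inferInstance
    refine (dichotomy hn (hM _)).resolve_right fun h => hI.1 fun x hx => ?_
    obtain ⟨a, ha, hax⟩ := h ((f₀.comp (c q.out⁻¹)) x)
    have h3 : a⁻¹ * x ∈ L ⊓ R q := by
      refine ⟨L.mul_mem (L.inv_mem ha.1) hx, ?_⟩
      change _ = _
      rw [map_mul, map_inv, hax, inv_mul_cancel]
    have h4 := mul_mem ha.2 (h1 h3)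
    simpa using h4
  let N : Subgroup G := (f₀.ker.map H₀.subtype).normalCore
  have hNmem (x : L) : ((x : H₀) : G) ∈ N ↔ (x : H₀) ∈ f₀.ker := by
    constructor
    · intro h
      obtain ⟨y, hy, hyx⟩ := Subgroup.normalCore_le _ h
      rwa [← Subtype.ext hyx]
    · intro h g
      obtain ⟨q, hq⟩ := hR g
      have h1 : (x : H₀) ∈ M g := hq ▸ hLR q ⟨x.2, h⟩
      exact ⟨c g x, h1, by simp [c]⟩
  let φ : L →* G ⧸ N := (QuotientGroup.mk' N).comp (H₀.subtype.comp L.subtype)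
  let ψ : L →* S := f₀.comp L.subtype
  have hψ : Function.Surjective ψ := by
    intro s
    obtain ⟨x, hx, rfl⟩ := ((dichotomy hLn hf₀).resolve_left hI.1) s
    exact ⟨⟨x, hx⟩, rfl⟩
  have hker : ψ.ker = φ.ker := by
    ext x
    rw [MonoidHom.mem_ker, MonoidHom.mem_ker]
    simp only [φ, MonoidHom.comp_apply, QuotientGroup.mk'_apply, QuotientGroup.eq_one_iff]
    exact (hNmem x).symm
  refine ⟨N, inferInstance, (QuotientGroup.kerLift φ).comp
    ((QuotientGroup.quotientMulEquivOfEq hker).toMonoidHom.comp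
      (QuotientGroup.quotientKerEquivOfSurjective ψ hψ).symm.toMonoidHom), ?_⟩
  exact (QuotientGroup.kerLift_injective φ).comp
    ((QuotientGroup.quotientMulEquivOfEq hker).injective.comp
      (QuotientGroup.quotientKerEquivOfSurjective ψ hψ).symm.injective)

/-- The unrestricted permutational wreath product of `F` by the symmetric group on `Ω`. -/
abbrev PermWreath (Ω F : Type*) [Group F] :=
  (Ω → F) ⋊[(mulAutArrow : Equiv.Perm Ω →* MulAut (Ω → F))] Equiv.Perm Ω

theorem PermWreath.mul_left_apply {Ω F : Type*} [Group F] (x y : PermWreath Ω F) (ω : Ω) :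
    (x * y).left ω = x.left ω * y.left (x.right⁻¹ ω) := rfl

theorem PermWreath.mul_left_apply' {Ω F : Type*} [Group F] (x y : PermWreath Ω F) (ω : Ω) :
    (x * y).left (x.right ω) = x.left (x.right ω) * y.left ω := by
  rw [PermWreath.mul_left_apply]
  rw [show x.right⁻¹ (x.right ω) = ω from x.right.symm_apply_apply ω]

/-- A homomorphism to a permutational wreath product gives a homomorphism from a point stabiliser
to the base group, which is onto as soon as generators are attained. -/
theorem exists_finiteIndex_surjective_of_permWreath {K Ω F : Type*} [Group K] [Group F] [Finite Ω]
    (Ψ : K →* PermWreath Ω F) (ω : Ω) (s : Set F) (hs : Subgroup.closure s = ⊤)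
    (h : ∀ x ∈ s, ∃ k, (Ψ k).right ω = ω ∧ (Ψ k).left ω = x) :
    ∃ H : Subgroup K, H.FiniteIndex ∧ ∃ f : H →* F, Function.Surjective f := by
  let H : Subgroup K := (MulAction.stabilizer (Equiv.Perm Ω) ω).comap
    (SemidirectProduct.rightHom.comp Ψ)
  have hH (k : K) : k ∈ H ↔ (Ψ k).right ω = ω := Iff.rfl
  let f : H →* F :=
    { toFun := fun k => (Ψ k).left ω
      map_one' := by simp
      map_mul' := fun a b => by
        have h1 := PermWreath.mul_left_apply' (Ψ a) (Ψ b) ω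
        rw [(hH a).1 a.2] at h1
        simpa using h1 }
  refine ⟨H, ?_, f, ?_⟩
  · have : (MulAction.stabilizer (Equiv.Perm Ω) ω).IsFiniteRelIndex
      (SemidirectProduct.rightHom.comp Ψ).range := Subgroup.isFiniteRelIndex_of_finiteIndex
    exact ⟨by rw [Subgroup.index_comap]; exact Subgroup.relIndex_ne_zero⟩
  · rw [← MonoidHom.range_eq_top, eq_top_iff, ← hs, Subgroup.closure_le]
    intro x hx
    obtain ⟨k, hk, rfl⟩ := h x hx
    exact ⟨⟨k, hk⟩, rfl⟩

/-- A finitely generated group is a quotient of a finite-index subgroup of a free group of rank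
two. -/
theorem exists_finiteIndex_freeGroup_two_surjective (S : Type*) [Group S] [Group.FG S] :
    ∃ H : Subgroup (FreeGroup (Fin 2)), H.FiniteIndex ∧
      ∃ f : H →* S, Function.Surjective f := by
  classical
  obtain ⟨t, ht⟩ := Group.FG.out (G := S)
  let T : Finset S := insert 1 t
  have : NeZero T.card := ⟨(Finset.card_pos.2 ⟨1, Finset.mem_insert_self 1 t⟩).ne'⟩
  let κ : ZMod T.card ≃ T := (ZMod.finEquiv T.card).symm.toEquiv.trans T.equivFin.symm
  let ρ : Equiv.Perm (ZMod T.card) := Equiv.addRight 1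
  let Ψ : FreeGroup (Fin 2) →* PermWreath (ZMod T.card) S :=
    FreeGroup.lift ![SemidirectProduct.inr ρ, SemidirectProduct.inl fun i => (κ i : S)]
  refine exists_finiteIndex_surjective_of_permWreath Ψ 0 (T : Set S) ?_ fun x hx => ?_
  · rw [eq_top_iff, ← ht]
    exact Subgroup.closure_mono (by simp [T])
  · obtain ⟨i, hi⟩ := κ.surjective ⟨x, hx⟩
    have hρ : (ρ ^ i.val) 0 = i := by
      simp [ρ, Equiv.nsmul_addRight]
    have h0 : Ψ ((FreeGroup.of 0 ^ i.val)⁻¹ * FreeGroup.of 1 * FreeGroup.of 0 ^ i.val) =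
        (SemidirectProduct.inr (ρ ^ i.val))⁻¹ * SemidirectProduct.inl (fun i => (κ i : S)) *
          SemidirectProduct.inr (ρ ^ i.val) := by
      simp [Ψ]
    refine ⟨(FreeGroup.of 0 ^ i.val)⁻¹ * FreeGroup.of 1 * FreeGroup.of 0 ^ i.val, ?_, ?_⟩
    · rw [h0]
      simp
    · rw [h0]
      generalize ρ ^ i.val = τ at hρ
      rw [← map_inv, PermWreath.mul_left_apply, PermWreath.mul_left_apply]
      simp [hρ, hi]

/-- A group with a finite-index subgroup mapping onto a free group of rank two has every countable
group as a subgroup of a quotient. -/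
theorem exists_embedding_quotient_of_large {G : Type*} [Group G] (H : Subgroup G) [H.FiniteIndex]
    (f : H →* FreeGroup (Fin 2)) (hf : Function.Surjective f) (C : Type) [Group C] [Countable C] :
    ∃ (N : Subgroup G) (_ : N.Normal) (ι : C →* G ⧸ N), Function.Injective ι := by
  obtain ⟨S, _, j, _, _, _, hj⟩ := exists_fg_infinite_simple C
  obtain ⟨H₁, _, f₁, hf₁⟩ := exists_finiteIndex_freeGroup_two_surjective S
  let H₂ : Subgroup G := (H₁.comap f).map H.subtype
  have hmem (x : H₂) : ∃ y : H, (y : G) = x ∧ f y ∈ H₁ := by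
    obtain ⟨y, hy, hyx⟩ := x.2
    exact ⟨y, hyx, hy⟩
  have hle : H₂ ≤ H := Subgroup.map_subtype_le _
  have : H₂.FiniteIndex := by
    constructor
    rw [Subgroup.index_map_subtype]
    rw [Subgroup.index_comap_of_surjective _ hf]
    exact mul_ne_zero Subgroup.FiniteIndex.index_ne_zero Subgroup.FiniteIndex.index_ne_zero
  let r : H₂ →* H₁ := (f.comp (Subgroup.inclusion hle)).codRestrict H₁ fun x => by
    obtain ⟨y, hy, hyf⟩ := hmem x
    have : Subgroup.inclusion hle x = y := Subtype.ext hy.symm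
    simpa [this] using hyf
  have hr : Function.Surjective r := by
    intro z
    obtain ⟨y, hy⟩ := hf z
    exact ⟨⟨y, y, by simp [hy], rfl⟩, Subtype.ext hy⟩
  obtain ⟨N, hN, ι, hι⟩ :=
    exists_embedding_quotient_of_finiteIndex H₂ (f₁.comp r) (hf₁.comp hr)
  exact ⟨N, hN, ι.comp j, hι.comp hj⟩

namespace TwoByTwo

universe u

open Polynomial

section Ring

variable {R : Type*} [CommRing R]

/-- A family of rank one idempotent matrices. -/
def idem (x t : R) : Matrix (Fin 2) (Fin 2) R :=
  !![1 - t * x, t; x - t * x ^ 2, t * x]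

theorem idem_mul_idem (x t : R) : idem x t * idem x t = idem x t := by
  ext i j
  fin_cases i <;> fin_cases j <;> simp [idem] <;> ring

/-- The matrices with eigenvalues `1` and `c` and fixed eigenvectors. -/
def twist (x t : R) : R →* Matrix (Fin 2) (Fin 2) R where
  toFun c := idem x t + c • (1 - idem x t)
  map_one' := by simp
  map_mul' c d := by
    have h : (idem x t + c • (1 - idem x t)) * (idem x t + d • (1 - idem x t)) =
        idem x t * idem x t + (c + d) • (idem x t - idem x t * idem x t) +
          (c * d) • (1 - idem x t - idem x t + idem x t * idem x t) := by
      simp only [mul_add, add_mul, smul_mul_assoc, mul_smul_comm, mul_sub, sub_mul, one_mul,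
        mul_one]
      module
    rw [h, idem_mul_idem]
    module

theorem twist_apply (x t c : R) : twist x t c =
    !![1 - t * x + c * (t * x), t - c * t; x - t * x ^ 2 - c * (x - t * x ^ 2),
      t * x + c * (1 - t * x)] := by
  ext i j
  fin_cases i <;> fin_cases j <;> simp [twist, idem] <;> ring

theorem map_twist {R' : Type*} [CommRing R'] (φ : R →+* R') (x t c : R) :
    φ.mapMatrix (twist x t c) = twist (φ x) (φ t) (φ c) := by
  rw [twist_apply, twist_apply]
  ext i j
  fin_cases i <;> fin_cases j <;> simp

theorem det_twist (x t c : R) : (twist x t c).det = c := by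
  rw [twist_apply, Matrix.det_fin_two_of]
  ring

theorem coeff_list_prod (L : List (Matrix (Fin 2) (Fin 2) R[X]))
    (h : ∀ M ∈ L, ∀ a b, (M a b).natDegree ≤ 1) (a b : Fin 2) :
    (L.prod a b).natDegree ≤ L.length ∧ (L.prod a b).coeff L.length =
      (L.map fun M => M.map fun q => q.coeff 1).prod a b := by
  induction L generalizing a b with
  | nil => by_cases hab : a = b <;> simp [hab]
  | cons M L ih =>
    have ih' := ih fun M' hM' => h M' (List.mem_cons_of_mem _ hM')
    have hM := h M List.mem_cons_self
    rw [List.prod_cons, List.map_cons, List.prod_cons, Matrix.mul_apply, Matrix.mul_apply,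
      List.length_cons, add_comm]
    constructor
    · refine natDegree_sum_le_of_forall_le _ _ fun c _ => ?_
      exact natDegree_mul_le_of_le (hM a c) (ih' c b).1
    · rw [finsetSum_coeff]
      refine Finset.sum_congr rfl fun c _ => ?_
      rw [coeff_mul_add_eq_of_natDegree_le (hM a c) (ih' c b).1, (ih' c b).2]
      rfl

end Ring

section Field

variable {F : Type u} [Field F]

/-- The leading matrices of the family, as rank one matrices. -/
def lead (q : F × F) : Matrix (Fin 2) (Fin 2) F :=
  (1 - q.2) • Matrix.vecMulVec ![1, q.1] ![-q.1, 1]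

theorem prod_lead (q : F × F) (l : List (F × F)) (hc : ∀ r ∈ q :: l, r.2 ≠ 1)
    (hl : (q :: l).IsChain (fun a b => a.1 ≠ b.1)) :
    ∃ k : F, k ≠ 0 ∧ ((q :: l).map lead).prod =
      k • Matrix.vecMulVec ![1, q.1] ![-((q :: l).getLast (by simp)).1, 1] := by
  induction l generalizing q with
  | nil =>
    refine ⟨1 - q.2, sub_ne_zero.2 (hc q (by simp)).symm, ?_⟩
    simp [lead]
  | cons r l ih =>
    rw [List.isChain_cons_cons] at hl
    obtain ⟨k, hk, hprod⟩ := ih r (fun s hs => hc s (List.mem_cons_of_mem _ hs)) hl.2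
    refine ⟨(1 - q.2) * (r.1 - q.1) * k, mul_ne_zero (mul_ne_zero
      (sub_ne_zero.2 (hc q (by simp)).symm) (sub_ne_zero.2 hl.1.symm)) hk, ?_⟩
    rw [List.map_cons, List.prod_cons, hprod,
      show (q :: r :: l).getLast (by simp) = (r :: l).getLast (by simp) from
        List.getLast_cons (by simp)]
    generalize (r :: l).getLast (by simp) = s
    ext i j
    fin_cases i <;> fin_cases j <;>
      simp [lead, Matrix.mul_apply] <;> ring

/-- The trace, as a polynomial in `t`, of a product of matrices of the family. -/
noncomputable def tracePoly (l : List (F × F)) : F[X] :=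
  ((l.map fun q => twist (C q.1) X (C q.2)).prod).trace

theorem natDegree_tracePoly (q : F × F) (l : List (F × F)) (hc : ∀ r ∈ q :: l, r.2 ≠ 1)
    (hl : (q :: l).IsChain (fun a b => a.1 ≠ b.1))
    (hlast : ((q :: l).getLast (by simp)).1 ≠ q.1) :
    (tracePoly (q :: l)).natDegree = l.length + 1 := by
  obtain ⟨k, hk, hprod⟩ := prod_lead q l hc hl
  have hdeg : ∀ M ∈ ((q :: l).map fun q => twist (C q.1) X (C q.2)), ∀ a b,
      (M a b).natDegree ≤ 1 := by
    intro M hM a b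
    obtain ⟨r, -, rfl⟩ := List.mem_map.1 hM
    rw [twist_apply]
    fin_cases a <;> fin_cases b <;> simp <;> compute_degree
  have hcoeff : ((q :: l).map fun q => twist (C q.1) X (C q.2)).map
      (fun M => M.map fun q => q.coeff 1) = (q :: l).map lead := by
    rw [List.map_map]
    refine List.map_congr_left fun r _ => ?_
    have hC : (C r.1 ^ 2 : F[X]).coeff 0 = r.1 ^ 2 := by rw [← C_pow, coeff_C_zero]
    ext i j
    rw [Function.comp_apply, twist_apply]
    fin_cases i <;> fin_cases j <;> simp [hC, lead, coeff_one, coeff_C,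
      sub_mul] <;> ring
  have hlen : ((q :: l).map fun q => twist (C q.1) X (C q.2)).length = l.length + 1 := by simp
  have key := coeff_list_prod _ hdeg
  rw [hcoeff, hprod, hlen] at key
  rw [tracePoly, Matrix.trace_fin_two]
  refine natDegree_eq_of_le_of_coeff_ne_zero
    (natDegree_add_le_of_degree_le (key 0 0).1 (key 1 1).1) ?_
  rw [coeff_add, (key 0 0).2, (key 1 1).2]
  have : k * (q.1 - ((q :: l).getLast (by simp)).1) ≠ 0 := mul_ne_zero hk (sub_ne_zero.2 hlast.symm)
  convert this using 1
  simp
  ring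

theorem orderOf_eq_of_trace_det {N : ℕ} (hN : 0 < N) {z z' : F} (hz : IsPrimitiveRoot z N)
    (hz' : z' ^ N = 1) (hne : z ≠ z') (M : Matrix (Fin 2) (Fin 2) F) (htr : M.trace = z + z')
    (hdet : M.det = z * z') : orderOf M = N := by
  have hM : M * M = (z + z') • M - (z * z') • 1 := by
    rw [← htr, ← hdet, Matrix.trace_fin_two, Matrix.det_fin_two]
    ext i j
    fin_cases i <;> fin_cases j <;> simp [Matrix.mul_apply] <;> ring
  have hpow (k : ℕ) : (z - z') • M ^ k = z ^ k • (M - z' • 1) - z' ^ k • (M - z • 1) := by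
    induction k with
    | zero => simp [sub_smul]
    | succ k ih =>
      rw [pow_succ, ← smul_mul_assoc, ih]
      simp only [sub_mul, smul_mul_assoc, one_mul, hM, pow_succ]
      module
  have hsub : z - z' ≠ 0 := sub_ne_zero.2 hne
  refine (orderOf_eq_iff hN).2 ⟨?_, fun k hk hk0 h => ?_⟩
  · have h1 := hpow N
    rw [hz.pow_eq_one, hz', one_smul, one_smul] at h1
    have h2 : (z - z') • M ^ N = (z - z') • (1 : Matrix (Fin 2) (Fin 2) F) := by
      rw [h1]; module
    exact smul_right_injective _ hsub h2
  · have h1 := hpow k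
    rw [h] at h1
    have h2 : ((z - z') * (z ^ k - 1)) • (M - z' • 1) = 0 := by
      have h3 := congrArg (fun A => A * (M - z' • 1)) h1
      simp only [sub_mul, smul_mul_assoc, one_mul, mul_sub, mul_smul_comm, mul_one, hM] at h3
      have h4 := sub_eq_zero.2 h3.symm
      rw [← h4]
      module
    rcases smul_eq_zero.1 h2 with h3 | h3
    · have h4 : z ^ k = 1 := sub_eq_zero.1 ((mul_eq_zero.1 h3).resolve_left hsub)
      exact absurd (Nat.le_of_dvd hk0 (hz.dvd_of_pow_eq_one k h4)) (not_le.2 hk)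
    · rw [sub_eq_zero.1 h3, Matrix.trace_smul, Matrix.trace_one] at htr
      apply hne
      simp at htr
      linear_combination -htr

/-- Over a finite extension the parameter can be chosen so that a given cyclically reduced product
of matrices of the family has any prescribed order (for which there are enough roots of unity). -/
theorem exists_orderOf_prod_eq {N : ℕ} (hN : 5 ≤ N) {z : F} (hz : IsPrimitiveRoot z N)
    (q : F × F) (l : List (F × F)) (hc : ∀ r ∈ q :: l, r.2 ≠ 1)
    (hcN : ∀ r ∈ q :: l, r.2 ^ N = 1)
    (hl : (q :: l).IsChain (fun a b => a.1 ≠ b.1))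
    (hlast : ((q :: l).getLast (by simp)).1 ≠ q.1) :
    ∃ (K : Type u) (_ : Field K) (_ : Algebra F K) (_ : FiniteDimensional F K) (t : K),
      orderOf (((q :: l).map fun r =>
        twist (algebraMap F K r.1) t (algebraMap F K r.2)).prod) = N := by
  set δ : F := ((q :: l).map Prod.snd).prod with hδ
  have hδN : δ ^ N = 1 := by
    have h1 : ∀ r ∈ (q :: l).map Prod.snd, r ^ N = 1 := by
      intro r hr
      obtain ⟨s, hs, rfl⟩ := List.mem_map.1 hr
      exact hcN s hs
    have h2 := Submonoid.list_prod_mem (MonoidHom.mker (powMonoidHom N : F →* F)) h1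
    exact h2
  have hz0 : z ≠ 0 := hz.ne_zero (by omega)
  have hzz : ∃ z₁ z₂ : F, IsPrimitiveRoot z₁ N ∧ z₂ ^ N = 1 ∧ z₁ ≠ z₂ ∧ z₁ * z₂ = δ := by
    by_cases h : δ = z ^ 2
    · refine ⟨z⁻¹, δ * z, hz.inv, by rw [mul_pow, hδN, hz.pow_eq_one, one_mul], fun h1 => ?_,
        by field_simp⟩
      have h2 : z ^ 4 = 1 := by
        rw [h] at h1
        calc z ^ 4 = (z ^ 2 * z) * z := by ring
          _ = 1 := by rw [← h1, inv_mul_cancel₀ hz0]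
      have := Nat.le_of_dvd (by norm_num) (hz.dvd_of_pow_eq_one 4 h2)
      omega
    · refine ⟨z, δ / z, hz, by rw [div_pow, hδN, hz.pow_eq_one, one_div_one], fun h1 => ?_,
        by field_simp⟩
      apply h
      rw [eq_div_iff hz0] at h1
      rw [← h1, sq]
  obtain ⟨z₁, z₂, h₁, h₂, h₁₂, hprod⟩ := hzz
  have hdeg := natDegree_tracePoly q l hc hl hlast
  set f : F[X] := tracePoly (q :: l) - C (z₁ + z₂) with hf
  have hfdeg : f.natDegree = l.length + 1 := by rw [hf, natDegree_sub_C, hdeg]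
  have hf0 : f.degree ≠ 0 := by
    intro h
    rw [natDegree_eq_zero_iff_degree_le_zero.2 h.le] at hfdeg
    omega
  obtain ⟨t, ht⟩ := (SplittingField.splits f).exists_eval_eq_zero (by rwa [degree_map])
  refine ⟨f.SplittingField, inferInstance, inferInstance, inferInstance, t, ?_⟩
  set φ : F[X] →+* f.SplittingField := eval₂RingHom (algebraMap F f.SplittingField) t
  have hM : ((q :: l).map fun r => twist (algebraMap F f.SplittingField r.1) t
      (algebraMap F f.SplittingField r.2)).prod =
      φ.mapMatrix ((q :: l).map fun q => twist (C q.1) X (C q.2)).prod := by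
    rw [map_list_prod, List.map_map]
    congr 1
    refine List.map_congr_left fun r _ => ?_
    rw [Function.comp_apply, map_twist]
    simp [φ]
  have hinj := (algebraMap F f.SplittingField).injective
  refine orderOf_eq_of_trace_det (by omega) (h₁.map_of_injective hinj)
    (z' := algebraMap F f.SplittingField z₂) (by rw [← map_pow, h₂, map_one])
    (fun h => h₁₂ (hinj h)) _ ?_ ?_
  · have h3 : φ (tracePoly (q :: l)) = algebraMap F f.SplittingField (z₁ + z₂) := by
      rw [eval_map, ← coe_eval₂RingHom] at ht
      have h4 : φ f = φ (tracePoly (q :: l)) - φ (C (z₁ + z₂)) := map_sub φ _ _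
      rw [show φ f = 0 from ht] at h4
      rw [sub_eq_zero.1 h4.symm]
      simp [φ]
    rw [hM, ← map_add, ← h3, tracePoly, Matrix.trace_fin_two, Matrix.trace_fin_two, map_add]
    rfl
  · rw [← map_mul, hprod, hδ, map_list_prod, ← Matrix.coe_detMonoidHom, map_list_prod,
      List.map_map, List.map_map]
    congr 1
    refine List.map_congr_left fun r _ => ?_
    simp [det_twist]

end Field

end TwoByTwo

/-- Relators for the free product of the cyclic groups of orders `e i`, `i ∈ S`, where the
generators with index in `T` are killed. -/
def sideRels {n : ℕ} (S T : Set (Fin n)) (e : Fin n → ℕ) : Set (FreeGroup (Fin n)) :=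
  {w | ∃ i : Fin n, i ∈ S ∧ w = FreeGroup.of i ^ e i} ∪
    {w | ∃ i : Fin n, i ∈ T ∧ w = FreeGroup.of i}

/-- The free product of the cyclic groups of orders `e i`, `i ∈ S`. -/
abbrev SideGroup {n : ℕ} (S T : Set (Fin n)) (e : Fin n → ℕ) := PresentedGroup (sideRels S T e)

namespace SideGroup

variable {n : ℕ} {S T : Set (Fin n)} {e : Fin n → ℕ}

/-- The generators of a free product of cyclic groups. -/
abbrev gen (i : Fin n) : SideGroup S T e := PresentedGroup.of i

theorem gen_pow {i : Fin n} (hi : i ∈ S) : (gen i : SideGroup S T e) ^ e i = 1 := by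
  rw [gen, PresentedGroup.of, ← map_pow]
  exact PresentedGroup.one_of_mem (Or.inl ⟨i, hi, rfl⟩)

theorem gen_eq_one {i : Fin n} (hi : i ∈ T) : (gen i : SideGroup S T e) = 1 :=
  PresentedGroup.one_of_mem (Or.inr ⟨i, hi, rfl⟩)

section Lift

variable {H : Type*} [Group H] (f : Fin n → H)

/-- The universal property of a free product of cyclic groups. -/
def lift (hS : ∀ i ∈ S, f i ^ e i = 1) (hT : ∀ i ∈ T, f i = 1) : SideGroup S T e →* H :=
  PresentedGroup.toGroup (f := f) (by
    rintro r (⟨i, hi, rfl⟩ | ⟨i, hi, rfl⟩)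
    · simpa using hS i hi
    · simpa using hT i hi)

theorem lift_gen (hS : ∀ i ∈ S, f i ^ e i = 1) (hT : ∀ i ∈ T, f i = 1) (i : Fin n) :
    lift f hS hT (gen i) = f i :=
  PresentedGroup.toGroup.of _

end Lift

/-- The element represented by a list of syllables. -/
def listProd (S T : Set (Fin n)) (e : Fin n → ℕ) (l : List (Fin n × ℤ)) : SideGroup S T e :=
  (l.map fun q => gen q.1 ^ q.2).prod

theorem exists_listProd_eq (g : SideGroup S T e) : ∃ l, listProd S T e l = g := by
  have hg : g ∈ Subgroup.closure (Set.range (gen : Fin n → SideGroup S T e)) := by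
    rw [PresentedGroup.closure_range_of]; trivial
  induction hg using Subgroup.closure_induction with
  | mem x hx =>
    obtain ⟨i, rfl⟩ := hx
    exact ⟨[(i, 1)], by simp [listProd]⟩
  | one => exact ⟨[], rfl⟩
  | mul x y _ _ hx hy =>
    obtain ⟨l, rfl⟩ := hx
    obtain ⟨m, rfl⟩ := hy
    exact ⟨l ++ m, by simp [listProd]⟩
  | inv x _ hx =>
    obtain ⟨l, rfl⟩ := hx
    refine ⟨l.reverse.map fun q => (q.1, -q.2), ?_⟩
    simp only [listProd, List.prod_inv_reverse, List.map_map, List.map_reverse]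
    congr 2
    refine List.map_congr_left fun q _ => ?_
    simp

theorem isConj_listProd_append (a b : List (Fin n × ℤ)) :
    IsConj (listProd S T e (a ++ b)) (listProd S T e (b ++ a)) := by
  simp only [listProd, List.map_append, List.prod_append]
  exact isConj_iff.2 ⟨(List.map (fun q => gen q.1 ^ q.2) a).prod⁻¹, by group⟩

/-- Every element is conjugate to one given by a cyclically reduced list of syllables. -/
theorem exists_isConj_listProd (hST : ∀ i, i ∈ T ↔ i ∉ S) (g : SideGroup S T e) :
    ∃ l : List (Fin n × ℤ), IsConj g (listProd S T e l) ∧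
      (∀ q ∈ l, q.1 ∈ S ∧ ¬ (e q.1 : ℤ) ∣ q.2) ∧
      (l.length ≤ 1 ∨ ∃ q r, l = q :: r ∧ (q :: r).IsChain (fun a b => a.1 ≠ b.1) ∧
        ((q :: r).getLast (by simp)).1 ≠ q.1) := by
  classical
  let 𝓛 : Set (List (Fin n × ℤ)) := {l | IsConj g (listProd S T e l)}
  have hne : 𝓛.Nonempty := by
    obtain ⟨l, hl⟩ := exists_listProd_eq g
    exact ⟨l, by subst hl; exact IsConj.refl _⟩
  obtain ⟨l, hl, hmin⟩ : ∃ l ∈ 𝓛, ∀ l' ∈ 𝓛, l.length ≤ l'.length :=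
    ⟨_, Function.argminOn_mem List.length 𝓛 hne, fun l' h => Function.argminOn_le _ 𝓛 h⟩
  have hrot (a b : List (Fin n × ℤ)) (h : l = a ++ b) : b ++ a ∈ 𝓛 := by
    subst h
    exact IsConj.trans hl (isConj_listProd_append a b)
  have hhead (q : Fin n × ℤ) (hq : gen q.1 ^ q.2 = (1 : SideGroup S T e))
      (a b : List (Fin n × ℤ)) (h : l = a ++ q :: b) : False := by
    have h1 := hrot a (q :: b) h
    have h2 : b ++ a ∈ 𝓛 := by
      have : listProd S T e (q :: b ++ a) = listProd S T e (b ++ a) := by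
        simp [listProd, hq]
      change IsConj _ _ at h1 ⊢
      rwa [this] at h1
    have h3 := hmin _ h2
    rw [h] at h3
    simp at h3
    omega
  have hpair (q r : Fin n × ℤ) (t : List (Fin n × ℤ)) (h : q :: r :: t ∈ 𝓛)
      (hlen : l.length = t.length + 2) : q.1 ≠ r.1 := by
    intro hqr
    have h1 : (q.1, q.2 + r.2) :: t ∈ 𝓛 := by
      have : listProd S T e (q :: r :: t) = listProd S T e ((q.1, q.2 + r.2) :: t) := by
        simp [listProd, zpow_add, hqr, mul_assoc]
      change IsConj _ _ at h ⊢
      rwa [this] at h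
    have h2 := hmin _ h1
    simp at h2
    omega
  refine ⟨l, hl, fun q hq => ?_, ?_⟩
  · obtain ⟨a, b, hab⟩ := List.append_of_mem hq
    have hS : q.1 ∈ S := by
      by_contra hS
      exact hhead q (by rw [gen_eq_one ((hST _).2 hS), one_zpow]) a b hab
    refine ⟨hS, fun hdvd => ?_⟩
    obtain ⟨k, hk⟩ := hdvd
    exact hhead q (by rw [hk, zpow_mul, zpow_natCast, gen_pow hS, one_zpow]) a b hab
  · rcases l with _ | ⟨q, r⟩
    · left; simp
    rcases r.eq_nil_or_concat with rfl | ⟨r', s, rfl⟩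
    · left; simp
    right
    refine ⟨q, r' ++ [s], by simp, ?_, ?_⟩
    · by_contra hch
      obtain ⟨m, hm, hmm⟩ := List.exists_not_getElem_of_not_isChain hch
      apply hmm
      set L := q :: (r' ++ [s]) with hL
      have hLl : q :: r'.concat s = L := by simp [hL]
      rw [hLl] at hrot hpair
      have hdrop : L.drop m = L[m] :: L[m + 1] :: L.drop (m + 2) := by
        rw [List.drop_eq_getElem_cons (by omega), List.drop_eq_getElem_cons (by omega)]
      have h1 := hrot (L.take m) (L.drop m) (List.take_append_drop m L).symm
      rw [hdrop] at h1
      refine hpair _ _ _ h1 ?_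
      simp
      omega
    · have h1 := hrot (q :: r') [s] (by simp)
      have : (q :: (r' ++ [s])).getLast (by simp) = s := by simp
      rw [this]
      exact hpair s q r' h1 (by simp)

theorem exists_unit_isPrimitiveRoot {p N : ℕ} [Fact p.Prime] (hN : N ∣ p - 1) :
    ∃ u : (ZMod p)ˣ, IsPrimitiveRoot u N := by
  obtain ⟨g, hg⟩ := IsCyclic.exists_ofOrder_eq_natCard (α := (ZMod p)ˣ)
  have h1 := IsPrimitiveRoot.orderOf g
  rw [hg, Nat.card_eq_fintype_card, ZMod.card_units] at h1
  obtain ⟨k, hk⟩ := hN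
  exact ⟨g ^ k, h1.pow (Nat.sub_pos_of_lt (Fact.out : p.Prime).one_lt) (by rw [hk, mul_comm])⟩

/-- An element of infinite order in a free product of cyclic groups has images of every
sufficiently divisible order in finite groups. -/
theorem exists_finite_orderOf_eq (hST : ∀ i, i ∈ T ↔ i ∉ S) (he : ∀ i, e i = 0 ∨ 2 ≤ e i)
    (g : SideGroup S T e) (hg : ¬ IsOfFinOrder g) :
    ∃ L > 0, ∀ N > 0, L ∣ N → ∃ (P : Type) (_ : Group P) (_ : Finite P)
      (θ : SideGroup S T e →* P), orderOf (θ g) = N := by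
  classical
  obtain ⟨l, hconj, hl, hcase⟩ := exists_isConj_listProd hST g
  have horder {P : Type} [Group P] (θ : SideGroup S T e →* P) :
      orderOf (θ g) = orderOf (θ (listProd S T e l)) := by
    obtain ⟨c, hc⟩ := isConj_iff.1 hconj
    rw [← hc, map_mul, map_mul, map_inv, ← MulAut.conj_apply]
    exact ((MulAut.conj (θ c)).orderOf_eq _).symm
  have hfin : ¬ IsOfFinOrder (listProd S T e l) := by
    obtain ⟨c, hc⟩ := isConj_iff.1 hconj
    rwa [← hc, ← orderOf_eq_zero_iff, ← MulAut.conj_apply, MulEquiv.orderOf_eq,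
      orderOf_eq_zero_iff]
  rcases hcase with hlen | ⟨q, r, hqr, hchain, hlast⟩
  · rcases l with _ | ⟨⟨i, m⟩, r⟩
    · exact absurd IsOfFinOrder.one hfin
    obtain rfl : r = [] := by
      cases r with
      | nil => rfl
      | cons => simp at hlen
    obtain ⟨hiS, hdvd⟩ := hl (i, m) (by simp)
    have hprod : listProd S T e [(i, m)] = gen i ^ m := by simp [listProd]
    have hei : e i = 0 := by
      by_contra h0
      apply hfin
      rw [hprod]
      exact (isOfFinOrder_iff_pow_eq_one.2 ⟨e i, Nat.pos_of_ne_zero h0, gen_pow hiS⟩).zpow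
    have hm : m ≠ 0 := by
      rintro rfl
      exact hdvd (dvd_zero _)
    refine ⟨1, one_pos, fun N hN _ => ?_⟩
    have : NeZero (m.natAbs * N) := ⟨mul_ne_zero (Int.natAbs_ne_zero.2 hm) hN.ne'⟩
    refine ⟨Multiplicative (ZMod (m.natAbs * N)), inferInstance,
      inferInstanceAs (Finite (ZMod _)), lift (Pi.mulSingle i (Multiplicative.ofAdd 1)) ?_ ?_, ?_⟩
    · intro j hj
      by_cases hji : j = i
      · subst hji; simp [hei]
      · simp [Pi.mulSingle_eq_of_ne hji]
    · intro j hj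
      have hji : j ≠ i := by
        rintro rfl
        exact (hST j).1 hj hiS
      simp [Pi.mulSingle_eq_of_ne hji]
    · rw [horder, hprod, map_zpow, lift_gen, Pi.mulSingle_eq_same, ← ofAdd_zsmul,
        orderOf_ofAdd_eq_addOrderOf, zsmul_one]
      have h1 : addOrderOf ((m.natAbs : ℕ) : ZMod (m.natAbs * N)) = N := by
        rw [ZMod.addOrderOf_coe _ (NeZero.ne _), Nat.gcd_eq_right (Dvd.intro _ rfl),
          Nat.mul_div_cancel_left _ (Int.natAbs_pos.2 hm)]
      rcases Int.natAbs_eq m with h | h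
      · rw [h, Int.cast_natCast]
        rw [← h]; exact h1
      · rw [h, Int.cast_neg, Int.cast_natCast, addOrderOf_neg, ← h]
        exact h1
  · let B : ℕ := 2 + (l.map fun q => q.2.natAbs).sum
    let e' (i : Fin n) : ℕ := if e i = 0 then B else e i
    have he'0 (i) : 0 < e' i := by
      rcases he i with h | h
      · simp [e', h, B]
      · have : e i ≠ 0 := by omega
        simp only [e', this, if_false]; omega
    have he'dvd (i) : e' i ∣ e i := by
      by_cases h : e i = 0 <;> simp [e', h]
    have he'l : ∀ q ∈ l, ¬ (e' q.1 : ℤ) ∣ q.2 := by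
      intro q hq hd
      by_cases h : e q.1 = 0
      · simp only [e', h, if_true] at hd
        have h1 : q.2 ≠ 0 := by
          intro h0
          exact (hl q hq).2 (by simp [h0])
        have h2 := Int.natAbs_dvd_natAbs.2 hd
        have h3 := Nat.le_of_dvd (Int.natAbs_pos.2 h1) h2
        have h4 : q.2.natAbs ≤ (l.map fun q => q.2.natAbs).sum :=
          List.single_le_sum (by simp) _ (List.mem_map.2 ⟨q, hq, rfl⟩)
        simp only [Int.natAbs_natCast, B] at h3
        omega
      · simp only [e', h, if_false] at hd
        exact (hl q hq).2 hd
    refine ⟨5 * ∏ i, e' i, Nat.mul_pos (by norm_num) (Finset.prod_pos fun i _ => he'0 i),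
      fun N hN hLN => ?_⟩
    have hN5 : 5 ≤ N := Nat.le_of_dvd hN ((Dvd.intro _ rfl).trans hLN)
    have he'N (i) : e' i ∣ N :=
      ((Finset.dvd_prod_of_mem e' (Finset.mem_univ i)).trans (Dvd.intro_left _ rfl)).trans hLN
    obtain ⟨p, hp, hnp, hpN⟩ := Nat.exists_prime_gt_modEq_one n hN.ne'
    have : Fact p.Prime := ⟨hp⟩
    obtain ⟨u, hu⟩ := exists_unit_isPrimitiveRoot (p := p) (N := N)
      ((Nat.modEq_iff_dvd' hp.one_lt.le).1 hpN.symm)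
    let ω (i : Fin n) : (ZMod p)ˣ := u ^ (N / e' i)
    have hω (i) : IsPrimitiveRoot (ω i) (e' i) :=
      hu.pow hN (Nat.div_mul_cancel (he'N i)).symm
    let x (i : Fin n) : ZMod p := ((i : ℕ) : ZMod p)
    have hx : Function.Injective x := by
      intro i j hij
      have h1 := (ZMod.natCast_eq_natCast_iff' _ _ _).1 hij
      rw [Nat.mod_eq_of_lt (i.2.trans hnp), Nat.mod_eq_of_lt (j.2.trans hnp)] at h1
      exact Fin.ext h1
    let m (s : Fin n × ℤ) : ZMod p × ZMod p := (x s.1, ((ω s.1 ^ s.2 : (ZMod p)ˣ) : ZMod p))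
    obtain ⟨K, _, _, _, t, ht⟩ := TwoByTwo.exists_orderOf_prod_eq (N := N) hN5
      (IsPrimitiveRoot.coe_units_iff.2 hu) (m q) (r.map m)
      (by
        rw [← List.map_cons, ← hqr]
        intro a ha h1
        obtain ⟨b, hb, rfl⟩ := List.mem_map.1 ha
        apply he'l b hb
        rw [← (hω b.1).zpow_eq_one_iff_dvd]
        exact Units.ext h1)
      (by
        rw [← List.map_cons]
        intro a ha
        obtain ⟨b, hb, rfl⟩ := List.mem_map.1 ha
        have : (ω b.1 ^ b.2) ^ N = 1 := by
          simp only [ω]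
          rw [← zpow_natCast, zpow_comm, zpow_natCast, ← pow_mul, mul_comm, pow_mul,
            hu.pow_eq_one, one_pow, one_zpow]
        simpa [m] using congrArg Units.val this)
      (by
        rw [← List.map_cons, List.isChain_map]
        exact hchain.imp fun a b hab h => hab (hx h))
      (by
        have : (m q :: r.map m).getLast (by simp) = m ((q :: r).getLast (by simp)) := by
          rw [← List.getLast_map (f := m) (by simp)]
          rfl
        rw [this]
        exact fun h => hlast (hx h))
    have : Finite K := Module.finite_of_finite (ZMod p)
    let φ := algebraMap (ZMod p) K
    let A (i : Fin n) : (Matrix (Fin 2) (Fin 2) K)ˣ :=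
      if i ∈ S then Units.map (TwoByTwo.twist (φ (x i)) t) (Units.map φ (ω i)) else 1
    refine ⟨(Matrix (Fin 2) (Fin 2) K)ˣ, inferInstance, inferInstance, lift A ?_ ?_, ?_⟩
    · intro i hi
      obtain ⟨k, hk⟩ := he'dvd i
      simp only [A, hi, if_true]
      rw [← map_pow, ← map_pow, hk, pow_mul, (hω i).pow_eq_one, one_pow, map_one, map_one]
    · intro i hi
      simp [A, (hST i).1 hi]
    · rw [horder, ← orderOf_units, ← ht]
      congr 1
      rw [← List.map_cons, ← hqr, listProd, map_list_prod, ← Units.coeHom_apply, map_list_prod,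
        List.map_map, List.map_map, List.map_map]
      congr 1
      refine List.map_congr_left fun s hs => ?_
      simp only [Function.comp_apply, map_zpow, lift_gen, A, (hl s hs).1, if_true, m]
      rw [← map_zpow, ← map_zpow]
      rfl

end SideGroup

section Index

variable {G : Type*} [Group G] {K : Subgroup G}

theorem two_le_index_of_notMem (hK : K.index ≠ 0) {x : G} (hx : x ∉ K) : 2 ≤ K.index := by
  have : K.index ≠ 1 := fun h => hx (by rw [Subgroup.index_eq_one.1 h]; trivial)
  omega

theorem three_le_index_of_mul_notMem (hK : K.index ≠ 0) {a b : G} (ha : a ∉ K) (hb : b ∉ K)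
    (hab : a * b ∉ K) : 3 ≤ K.index := by
  have h2 := two_le_index_of_notMem hK ha
  have : K.index ≠ 2 := fun h => by
    have := Subgroup.mul_mem_iff_of_index_two h (a := a) (b := b)
    tauto
  omega

theorem three_le_index_of_sq_notMem (hK : K.index ≠ 0) {x : G} (hx : x ^ 2 ∉ K) :
    3 ≤ K.index := by
  have h1 : x ∉ K := fun h => hx (K.pow_mem h 2)
  exact three_le_index_of_mul_notMem hK h1 h1 (by rwa [← sq])

theorem index_comap_ne_zero {R : Type*} [Group R] [Finite R] (θ : G →* R) (H : Subgroup R) :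
    (H.comap θ).index ≠ 0 := by
  rw [Subgroup.index_comap]
  exact Subgroup.FiniteIndex.index_ne_zero

/-- A cyclic subgroup has index at least three as soon as two squares do not commute. -/
theorem three_le_index_comap_zpowers {R : Type*} [Group R] [Finite R] (θ : G →* R) (g x y : G)
    (h : ¬ Commute (θ x ^ 2) (θ y ^ 2)) : 3 ≤ ((Subgroup.zpowers (θ g)).comap θ).index := by
  by_cases hx : x ^ 2 ∈ (Subgroup.zpowers (θ g)).comap θ
  · by_cases hy : y ^ 2 ∈ (Subgroup.zpowers (θ g)).comap θ
    · rw [Subgroup.mem_comap, map_pow] at hx hy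
      obtain ⟨k, hk⟩ := hx
      obtain ⟨l, hl⟩ := hy
      refine absurd ?_ h
      rw [← hk, ← hl]
      exact (Commute.refl (θ g)).zpow_zpow k l
    · exact three_le_index_of_sq_notMem (index_comap_ne_zero θ _) hy
  · exact three_le_index_of_sq_notMem (index_comap_ne_zero θ _) hx

end Index

section CrossPerm

theorem prodExtendRight_pow {α β : Type*} [DecidableEq α] (a : α) (σ : Equiv.Perm β) (k : ℕ) :
    Equiv.Perm.prodExtendRight a σ ^ k = Equiv.Perm.prodExtendRight a (σ ^ k) := by
  induction k with
  | zero =>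
    ext ⟨x, y⟩ : 1
    by_cases h : x = a <;> simp [Equiv.Perm.prodExtendRight, h]
  | succ k ih =>
    ext ⟨x, y⟩ : 1
    rw [pow_succ, ih]
    by_cases h : x = a <;> simp [Equiv.Perm.prodExtendRight, h, pow_succ]

/-- There are two permutations of a finite set, of orders dividing `p` and `q`, such that the
group they generate has non-commuting squares. -/
theorem exists_perm_not_commute_sq {p q : ℕ} (hp : 2 ≤ p) (hq : 3 ≤ q) :
    ∃ (R : Type) (_ : Group R) (_ : Finite R) (a b : R), a ^ p = 1 ∧ b ^ q = 1 ∧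
      ¬ Commute (b ^ 2) ((a * b * a⁻¹) ^ 2) := by
  have : NeZero p := ⟨by omega⟩
  have : NeZero q := ⟨by omega⟩
  have : Fact (1 < p) := ⟨by omega⟩
  have : Fact (1 < q) := ⟨by omega⟩
  have h2 : (2 : ZMod q) ≠ 0 := by
    have := (ZMod.natCast_eq_zero_iff 2 q).not.2 (fun h => by have := Nat.le_of_dvd two_pos h; omega)
    exact_mod_cast this
  let a : Equiv.Perm (ZMod q × ZMod p) := Equiv.Perm.prodExtendRight 0 (Equiv.addRight 1)
  let b : Equiv.Perm (ZMod q × ZMod p) :=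
    (Equiv.prodComm (ZMod p) (ZMod q)).permCongrHom
      (Equiv.Perm.prodExtendRight 0 (Equiv.addRight 1))
  refine ⟨Equiv.Perm (ZMod q × ZMod p), inferInstance, inferInstance, a, b, ?_, ?_, ?_⟩
  · rw [prodExtendRight_pow]
    ext ⟨x, y⟩ : 1
    by_cases h : x = 0 <;> simp [Equiv.Perm.prodExtendRight, h]
  · rw [← map_pow, prodExtendRight_pow, map_eq_one_iff _ (MulEquiv.injective _)]
    ext ⟨x, y⟩ : 1
    by_cases h : x = 0 <;> simp [Equiv.Perm.prodExtendRight, h]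
  · have hb0 (x : ZMod q) : b (x, 0) = (x + 1, 0) := by
      simp [b, Equiv.Perm.prodExtendRight]
    have hb1 (x : ZMod q) (y : ZMod p) (hy : y ≠ 0) : b (x, y) = (x, y) := by
      simp [b, Equiv.Perm.prodExtendRight, hy]
    have ha0 (y : ZMod p) : a (0, y) = (0, y + 1) := by
      simp [a, Equiv.Perm.prodExtendRight]
    have ha1 (x : ZMod q) (y : ZMod p) (hx : x ≠ 0) : a (x, y) = (x, y) := by
      simp [a, Equiv.Perm.prodExtendRight, hx]
    intro h
    have h1 := Equiv.congr_fun h.eq (0, 0)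
    have e1 : a⁻¹ (0, 0) = (0, -1) := by
      rw [Equiv.Perm.inv_eq_iff_eq, ha0]; simp
    have e2 : a⁻¹ (2, 0) = (2, 0) := by
      rw [Equiv.Perm.inv_eq_iff_eq, ha1 _ _ h2]
    have hconj : (a * b * a⁻¹) ^ 2 = a * b * b * a⁻¹ := by simp [sq, mul_assoc]
    rw [hconj, sq] at h1
    simp only [Equiv.Perm.mul_apply, e1] at h1
    rw [hb1 0 (-1) (by simp), hb1 0 (-1) (by simp), ha0, neg_add_cancel, hb0, hb0, zero_add,
      one_add_one_eq_two, e2, hb0, hb0] at h1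
    by_cases h4 : (2 + 1 + 1 : ZMod q) = 0
    · rw [h4, ha0] at h1
      exact h2 (congrArg Prod.fst h1)
    · rw [ha1 _ _ h4] at h1
      have := congrArg Prod.fst h1
      simp only [add_assoc, left_eq_add, one_add_one_eq_two] at this
      exact h2 this

end CrossPerm

namespace SideGroup

variable {n : ℕ} {S T : Set (Fin n)} {e : Fin n → ℕ}

/-- The exceptional elements: the square of a generator of an infinite cyclic group, and the
product of the generating involutions of an infinite dihedral group. -/
def IsSmall (g : SideGroup S T e) : Prop :=
  (∃ i, S = {i} ∧ g = gen i ^ 2) ∨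
    ∃ i j, i ≠ j ∧ S = {i, j} ∧ e i = 2 ∧ e j = 2 ∧ g = gen i * gen j

theorem induction_gen {P : SideGroup S T e → Prop} (g : SideGroup S T e) (one : P 1)
    (mul_gen : ∀ g i, P g → P (g * gen i)) (mul_gen_inv : ∀ g i, P g → P (g * (gen i)⁻¹)) :
    P g := by
  have hg : g ∈ Subgroup.closure (Set.range (gen : Fin n → SideGroup S T e)) := by
    rw [PresentedGroup.closure_range_of]; trivial
  induction hg using Subgroup.closure_induction_right with
  | one => exact one
  | mul_right x hx y hy ih =>
    obtain ⟨i, rfl⟩ := hy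
    exact mul_gen x i ih
  | mul_inv_cancel x hx y hy ih =>
    obtain ⟨i, rfl⟩ := hy
    exact mul_gen_inv x i ih

theorem gen_mul_self {i : Fin n} (hi : i ∈ S) (h : e i = 2) :
    (gen i : SideGroup S T e) * gen i = 1 := by
  rw [← sq, ← h]
  exact gen_pow hi

/-- The normal form in the infinite dihedral group. -/
theorem eq_zpow_or_of_dihedral (hST : ∀ i, i ∈ T ↔ i ∉ S) {i j : Fin n} (hS : S = {i, j})
    (hi : e i = 2) (hj : e j = 2) (g : SideGroup S T e) :
    ∃ k : ℤ, g = (gen i * gen j) ^ k ∨ g = (gen i * gen j) ^ k * gen i := by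
  have ha : (gen i : SideGroup S T e) * gen i = 1 := gen_mul_self (by simp [hS]) hi
  have hb : (gen j : SideGroup S T e) * gen j = 1 := gen_mul_self (by simp [hS]) hj
  have hstep (x : SideGroup S T e) (l : Fin n)
      (hx : ∃ k : ℤ, x = (gen i * gen j) ^ k ∨ x = (gen i * gen j) ^ k * gen i) :
      ∃ k : ℤ, x * gen l = (gen i * gen j) ^ k ∨ x * gen l = (gen i * gen j) ^ k * gen i := by
    obtain ⟨k, hk⟩ := hx
    by_cases hl : l ∈ S
    · rw [hS] at hl
      rcases hl with rfl | rfl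
      · rcases hk with rfl | rfl
        · exact ⟨k, Or.inr rfl⟩
        · exact ⟨k, Or.inl (by rw [mul_assoc, ha, mul_one])⟩
      · rcases hk with rfl | rfl
        · refine ⟨k - 1, Or.inr ?_⟩
          rw [zpow_sub_one, mul_inv_rev, mul_assoc, mul_assoc, inv_mul_cancel, mul_one,
            inv_eq_of_mul_eq_one_left hb]
        · exact ⟨k + 1, Or.inl (by rw [zpow_add_one, mul_assoc])⟩
    · rw [gen_eq_one ((hST l).2 hl), mul_one]
      exact ⟨k, hk⟩
  have hinv (l : Fin n) : (gen l : SideGroup S T e)⁻¹ = gen l := by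
    by_cases hl : l ∈ S
    · rw [hS] at hl
      rcases hl with rfl | rfl
      · exact inv_eq_of_mul_eq_one_left ha
      · exact inv_eq_of_mul_eq_one_left hb
    · rw [gen_eq_one ((hST l).2 hl), inv_one]
  induction g using induction_gen with
  | one => exact ⟨0, Or.inl (by simp)⟩
  | mul_gen x l hx => exact hstep x l hx
  | mul_gen_inv x l hx => rw [hinv]; exact hstep x l hx

theorem exists_zpow_of_dihedral (hST : ∀ i, i ∈ T ↔ i ∉ S) {i j : Fin n} (hS : S = {i, j})
    (hi : e i = 2) (hj : e j = 2) (g : SideGroup S T e) (hg : ¬ IsOfFinOrder g) :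
    ∃ k : ℤ, k ≠ 0 ∧ g = (gen i * gen j) ^ k := by
  have ha : (gen i : SideGroup S T e) * gen i = 1 := gen_mul_self (by simp [hS]) hi
  have hb : (gen j : SideGroup S T e) * gen j = 1 := gen_mul_self (by simp [hS]) hj
  have hconj : gen i * (gen i * gen j) * (gen i : SideGroup S T e)⁻¹ = (gen i * gen j)⁻¹ := by
    rw [mul_inv_rev, ← mul_assoc, ha, one_mul, inv_eq_of_mul_eq_one_left hb]
  obtain ⟨k, rfl | rfl⟩ := eq_zpow_or_of_dihedral hST hS hi hj g
  · refine ⟨k, ?_, rfl⟩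
    rintro rfl
    exact hg (by rw [zpow_zero]; exact IsOfFinOrder.one)
  · refine absurd (isOfFinOrder_iff_pow_eq_one.2 ⟨2, two_pos, ?_⟩) hg
    have h1 : gen i * (gen i * gen j) ^ k = ((gen i * gen j : SideGroup S T e) ^ k)⁻¹ * gen i := by
      rw [← inv_zpow, ← hconj, conj_zpow, inv_mul_cancel_right]
    rw [sq, mul_assoc, ← mul_assoc (gen i), h1, mul_assoc, ha, mul_one, mul_inv_cancel]

open Subgroup in
theorem exists_index_of_two_ne_two (hST : ∀ i, i ∈ T ↔ i ∉ S) (he : ∀ i, e i = 0 ∨ 2 ≤ e i)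
    {i j : Fin n} (hi : i ∈ S) (hj : j ∈ S) (hij : i ≠ j) (hj2 : e j ≠ 2) (g : SideGroup S T e) :
    ∃ (R : Type) (_ : Group R) (_ : Finite R) (θ : SideGroup S T e →* R),
      3 ≤ ((zpowers (θ g)).comap θ).index := by
  classical
  obtain ⟨p, hp, hpe⟩ : ∃ p, 2 ≤ p ∧ p ∣ e i := by
    rcases he i with h | h
    · exact ⟨2, le_rfl, by simp [h]⟩
    · exact ⟨_, h, dvd_rfl⟩
  obtain ⟨q, hq, hqe⟩ : ∃ q, 3 ≤ q ∧ q ∣ e j := by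
    rcases he j with h | h
    · exact ⟨3, le_rfl, by simp [h]⟩
    · exact ⟨e j, by omega, dvd_rfl⟩
  obtain ⟨R, _, _, a, b, ha, hb, hab⟩ := exists_perm_not_commute_sq hp hq
  have hae : a ^ e i = 1 := by
    obtain ⟨k, hk⟩ := hpe
    rw [hk, pow_mul, ha, one_pow]
  have hbe : b ^ e j = 1 := by
    obtain ⟨k, hk⟩ := hqe
    rw [hk, pow_mul, hb, one_pow]
  let f (l : Fin n) : R := if l = i then a else if l = j then b else 1
  have hfi : f i = a := by simp [f]
  have hfj : f j = b := by simp [f, hij.symm]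
  refine ⟨R, inferInstance, inferInstance, lift f ?_ ?_,
    three_le_index_comap_zpowers _ g (gen j) (gen i * gen j * (gen i)⁻¹) ?_⟩
  · intro l _
    by_cases hli : l = i
    · rw [hli, hfi, hae]
    · by_cases hlj : l = j
      · rw [hlj, hfj, hbe]
      · simp [f, hli, hlj]
  · intro l hl
    have hli : l ≠ i := fun h => (hST l).1 hl (h ▸ hi)
    have hlj : l ≠ j := fun h => (hST l).1 hl (h ▸ hj)
    simp [f, hli, hlj]
  · rw [map_mul, map_mul, map_inv, lift_gen, lift_gen, hfi, hfj]
    exact hab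

open Subgroup in
theorem exists_index_of_three (hST : ∀ i, i ∈ T ↔ i ∉ S)
    {i j k : Fin n} (hi : i ∈ S) (hj : j ∈ S) (hk : k ∈ S) (hij : i ≠ j) (hik : i ≠ k)
    (hjk : j ≠ k) (hei : e i = 2) (hej : e j = 2) (hek : e k = 2) (g : SideGroup S T e) :
    ∃ (R : Type) (_ : Group R) (_ : Finite R) (θ : SideGroup S T e →* R),
      3 ≤ ((zpowers (θ g)).comap θ).index := by
  classical
  let f (l : Fin n) : Equiv.Perm (Fin 4) :=
    if l = i then Equiv.swap 0 1 else if l = j then Equiv.swap 1 2 else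
    if l = k then Equiv.swap 2 3 else 1
  have hfi : f i = Equiv.swap 0 1 := by simp [f]
  have hfj : f j = Equiv.swap 1 2 := by simp [f, hij.symm]
  have hfk : f k = Equiv.swap 2 3 := by simp [f, hik.symm, hjk.symm]
  refine ⟨Equiv.Perm (Fin 4), inferInstance, inferInstance, lift f ?_ ?_,
    three_le_index_comap_zpowers _ g (gen i * gen j) (gen j * gen k) ?_⟩
  · intro l _
    by_cases hli : l = i
    · rw [hli, hfi, hei]; decide
    · by_cases hlj : l = j
      · rw [hlj, hfj, hej]; decide
      · by_cases hlk : l = k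
        · rw [hlk, hfk, hek]; decide
        · simp [f, hli, hlj, hlk]
  · intro l hl
    have hli : l ≠ i := fun h => (hST l).1 hl (h ▸ hi)
    have hlj : l ≠ j := fun h => (hST l).1 hl (h ▸ hj)
    have hlk : l ≠ k := fun h => (hST l).1 hl (h ▸ hk)
    simp [f, hli, hlj, hlk]
  · rw [map_mul, map_mul, lift_gen, lift_gen, lift_gen, hfi, hfj, hfk]
    intro h
    exact absurd h.eq (by decide)

open Subgroup in
/-- A homomorphism to a finite group in which the image of `g` has index at least two, and at
least three unless `g` is exceptional. -/
theorem exists_index (hST : ∀ i, i ∈ T ↔ i ∉ S) (he : ∀ i, e i = 0 ∨ 2 ≤ e i)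
    (g : SideGroup S T e) (hg : ¬ IsOfFinOrder g)
    (hcase : (∃ i, ∃ m ≥ 2, S = {i} ∧ g = gen i ^ m) ∨ ∃ i ∈ S, ∃ j ∈ S, i ≠ j) :
    ∃ (R : Type) (_ : Group R) (_ : Finite R) (θ : SideGroup S T e →* R),
      2 ≤ ((zpowers (θ g)).comap θ).index ∧
        (¬ IsSmall g → 3 ≤ ((zpowers (θ g)).comap θ).index) := by
  classical
  have hthree (h : ∃ (R : Type) (_ : Group R) (_ : Finite R) (θ : SideGroup S T e →* R),
      3 ≤ ((zpowers (θ g)).comap θ).index) :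
    ∃ (R : Type) (_ : Group R) (_ : Finite R) (θ : SideGroup S T e →* R),
      2 ≤ ((zpowers (θ g)).comap θ).index ∧
        (¬ IsSmall g → 3 ≤ ((zpowers (θ g)).comap θ).index) := by
    obtain ⟨R, i1, i2, θ, h⟩ := h
    exact ⟨R, i1, i2, θ, by omega, fun _ => h⟩
  rcases hcase with ⟨i, m, hm, hS, rfl⟩ | ⟨i, hi, j, hj, hij⟩
  · have hei : e i = 0 := by
      by_contra h0
      exact hg (isOfFinOrder_iff_pow_eq_one.2
        ⟨e i, Nat.pos_of_ne_zero h0, gen_pow (by simp [hS])⟩).pow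
    have : NeZero m := ⟨by omega⟩
    let f : Fin n → Multiplicative (ZMod m) := Pi.mulSingle i (Multiplicative.ofAdd 1)
    let θ : SideGroup S T e →* Multiplicative (ZMod m) := lift f
      (by intro j hj; rw [hS] at hj; obtain rfl := hj; simp [hei])
      (by
        intro j hj
        have : j ≠ i := by rintro rfl; exact (hST j).1 hj (by simp [hS])
        simp [f, Pi.mulSingle_eq_of_ne this])
    have hθi : θ (gen i) = Multiplicative.ofAdd 1 := by simp [θ, lift_gen, f]
    have hθ (k : ℕ) : θ (gen i ^ k) = Multiplicative.ofAdd (k : ZMod m) := by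
      rw [map_pow, hθi, ← ofAdd_nsmul, nsmul_one]
    have hmem (k : ℕ) : gen i ^ k ∈ (zpowers (θ (gen i ^ m))).comap θ ↔ m ∣ k := by
      rw [mem_comap, hθ, hθ, ZMod.natCast_self, ofAdd_zero, zpowers_one_eq_bot, mem_bot,
        ofAdd_eq_one, ZMod.natCast_eq_zero_iff]
    have : Finite (Multiplicative (ZMod m)) := inferInstanceAs (Finite (ZMod m))
    refine ⟨Multiplicative (ZMod m), inferInstance, inferInstance, θ,
      two_le_index_of_notMem (index_comap_ne_zero θ _) (x := gen i ^ 1) ?_, fun hs =>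
        three_le_index_of_sq_notMem (index_comap_ne_zero θ _) (x := gen i) ?_⟩
    · rw [hmem]
      intro h
      have := Nat.le_of_dvd one_pos h
      omega
    · rw [hmem]
      intro h
      obtain rfl : m = 2 := le_antisymm (Nat.le_of_dvd two_pos h) hm
      exact hs (Or.inl ⟨i, hS, rfl⟩)
  by_cases hj2 : e j = 2
  swap
  · exact hthree (exists_index_of_two_ne_two hST he hi hj hij hj2 g)
  by_cases hi2 : e i = 2
  swap
  · exact hthree (exists_index_of_two_ne_two hST he hj hi hij.symm hi2 g)
  by_cases hk : ∃ k ∈ S, k ≠ i ∧ k ≠ j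
  · obtain ⟨k, hk, hki, hkj⟩ := hk
    by_cases hk2 : e k = 2
    · exact hthree (exists_index_of_three hST hi hj hk hij hki.symm hkj.symm hi2 hj2 hk2 g)
    · exact hthree (exists_index_of_two_ne_two hST he hi hk hki.symm hk2 g)
  have hS : S = {i, j} := by
    ext k
    constructor
    · intro h
      by_contra h'
      simp only [Set.mem_insert_iff, Set.mem_singleton_iff, not_or] at h'
      exact hk ⟨k, h, h'⟩
    · rintro (rfl | rfl) <;> assumption
  obtain ⟨k, hk0, rfl⟩ := exists_zpow_of_dihedral hST hS hi2 hj2 g hg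
  by_cases hk1 : k.natAbs = 1
  · have hsmall : IsSmall ((gen i * gen j : SideGroup S T e) ^ k) := by
      right
      rcases Int.natAbs_eq_iff.1 hk1 with rfl | rfl
      · exact ⟨i, j, hij, hS, hi2, hj2, by simp⟩
      · refine ⟨j, i, hij.symm, by rw [hS, Set.pair_comm], hj2, hi2, ?_⟩
        have ha : (gen i : SideGroup S T e) * gen i = 1 :=
          gen_mul_self hi hi2
        have hb : (gen j : SideGroup S T e) * gen j = 1 :=
          gen_mul_self hj hj2
        simp [inv_eq_of_mul_eq_one_left ha, inv_eq_of_mul_eq_one_left hb]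
    let f (l : Fin n) : ℤˣ := if l ∈ S then -1 else 1
    have hfi : f i = -1 := by simp [f, hi]
    have hfj : f j = -1 := by simp [f, hj]
    let θ : SideGroup S T e →* ℤˣ := lift f
      (by intro l hl; rw [hS] at hl; rcases hl with rfl | rfl <;> simp [hfi, hfj, hi2, hj2])
      (by intro l hl; simp [f, (hST l).1 hl])
    refine ⟨ℤˣ, inferInstance, inferInstance, θ, two_le_index_of_notMem (index_comap_ne_zero θ _)
      (x := gen i) ?_, fun h => absurd hsmall h⟩
    rw [mem_comap, map_zpow, map_mul]
    simp only [θ, lift_gen, hfi, hfj]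
    simp
  · have hk2 : 2 ≤ k.natAbs := by omega
    have : NeZero k.natAbs := ⟨by omega⟩
    have : Fact (1 < k.natAbs) := ⟨by omega⟩
    let f (l : Fin n) : DihedralGroup k.natAbs :=
      if l = i then .sr 0 else if l = j then .sr 1 else 1
    have hfi : f i = .sr 0 := by simp [f]
    have hfj : f j = .sr 1 := by simp [f, hij.symm]
    let θ : SideGroup S T e →* DihedralGroup k.natAbs := lift f
      (by
        intro l hl
        rw [hS] at hl
        rcases hl with rfl | rfl <;> simp [hfi, hfj, hi2, hj2, sq])
      (by
        intro l hl
        have hl := (hST l).1 hl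
        simp only [hS, Set.mem_insert_iff, Set.mem_singleton_iff, not_or] at hl
        simp [f, hl.1, hl.2])
    have hθi : θ (gen i) = .sr 0 := (lift_gen ..).trans hfi
    have hθj : θ (gen j) = .sr 1 := (lift_gen ..).trans hfj
    have hθg : θ ((gen i * gen j) ^ k) = 1 := by
      rw [map_zpow, map_mul, hθi, hθj, DihedralGroup.sr_mul_sr, sub_zero,
        ← orderOf_dvd_iff_zpow_eq_one, DihedralGroup.orderOf_r_one]
      exact Int.natAbs_dvd.2 dvd_rfl
    refine hthree ⟨DihedralGroup k.natAbs, inferInstance, inferInstance, θ,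
      three_le_index_of_mul_notMem (index_comap_ne_zero θ _) (a := gen i) (b := gen j) ?_ ?_ ?_⟩
    all_goals
      rw [hθg, zpowers_one_eq_bot, mem_comap, mem_bot]
      simp [hθi, hθj, DihedralGroup.one_def, -DihedralGroup.r_zero]

end SideGroup

/-- A finite group acts on itself in such a way that a given element `q` translates the
`q`-orbits. -/
theorem exists_perm_zmod_of_orderOf {Q : Type} [Group Q] [Finite Q] (q : Q) {N : ℕ} (hN : 0 < N)
    (hq : orderOf q = N) :
    ∃ A : Q →* Equiv.Perm ((Q ⧸ Subgroup.zpowers q) × ZMod N),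
      (∀ τ z, A q (τ, z) = (τ, z + 1)) ∧ ∀ x y, ∃ h, A h x = y := by
  have : NeZero N := ⟨hN.ne'⟩
  have hpow (a b : ℕ) : q ^ a = q ^ b ↔ (a : ZMod N) = b := by
    rw [pow_eq_pow_iff_modEq, hq, ZMod.natCast_eq_natCast_iff]
  let φ (x : (Q ⧸ Subgroup.zpowers q) × ZMod N) : Q := q ^ x.2.val * x.1.out⁻¹
  have hφ : Function.Bijective φ := by
    rw [Nat.bijective_iff_injective_and_card]
    constructor
    · rintro ⟨τ, a⟩ ⟨σ, b⟩ h
      simp only [φ] at h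
      have hτ : τ = σ := by
        rw [← QuotientGroup.out_eq' τ, ← QuotientGroup.out_eq' σ, QuotientGroup.eq]
        have h1 : τ.out⁻¹ * σ.out = (q ^ a.val)⁻¹ * q ^ b.val := by
          rw [eq_inv_mul_iff_mul_eq, ← mul_assoc, h, inv_mul_cancel_right]
        rw [h1]
        exact mul_mem (inv_mem (pow_mem (Subgroup.mem_zpowers q) _))
          (pow_mem (Subgroup.mem_zpowers q) _)
      subst hτ
      rw [mul_left_inj, hpow, ZMod.natCast_zmod_val, ZMod.natCast_zmod_val] at h
      rw [h]
    · rw [Nat.card_prod, Nat.card_zmod, ← hq, ← Nat.card_zpowers]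
      exact Subgroup.index_mul_card _
  let E := Equiv.ofBijective φ hφ
  refine ⟨E.symm.permCongrHom.toMonoidHom.comp (MulAction.toPermHom Q Q), fun τ z => ?_,
    fun x y => ⟨E y * (E x)⁻¹, ?_⟩⟩
  · change E.symm (q * E (τ, z)) = _
    rw [Equiv.symm_apply_eq]
    change q * (q ^ z.val * _) = q ^ (z + 1).val * _
    rw [← mul_assoc, ← pow_succ', mul_left_inj, hpow]
    simp
  · change E.symm (E y * (E x)⁻¹ * E x) = _
    simp

namespace SideGroup

variable {n : ℕ} {S T : Set (Fin n)} {e : Fin n → ℕ}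

/-- For every sufficiently divisible `N` there is a transitive action on a finite set `X × ℤ/N` in
which `g` acts by translation; the set `X` has at least two elements, and at least three unless
`g` is exceptional. -/
theorem exists_action (hST : ∀ i, i ∈ T ↔ i ∉ S) (he : ∀ i, e i = 0 ∨ 2 ≤ e i)
    (g : SideGroup S T e) (hg : ¬ IsOfFinOrder g)
    (hcase : (∃ i, ∃ m ≥ 2, S = {i} ∧ g = gen i ^ m) ∨ ∃ i ∈ S, ∃ j ∈ S, i ≠ j) :
    ∃ L > 0, ∀ N > 0, L ∣ N → ∃ (X : Type) (_ : Finite X)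
      (A : SideGroup S T e →* Equiv.Perm (X × ZMod N)),
      (∀ τ z, A g (τ, z) = (τ, z + 1)) ∧ (∀ x y, ∃ h, A h x = y) ∧
        2 ≤ Nat.card X ∧ (¬ IsSmall g → 3 ≤ Nat.card X) := by
  obtain ⟨R, _, _, θR, h2, h3⟩ := exists_index hST he g hg hcase
  obtain ⟨L, hL, hP⟩ := exists_finite_orderOf_eq hST he g hg
  refine ⟨L * Nat.card R, Nat.mul_pos hL Nat.card_pos, fun N hN hdvd => ?_⟩
  obtain ⟨P, _, _, θP, hθP⟩ := hP N hN ((Dvd.intro _ rfl).trans hdvd)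
  let θ := θP.prod θR
  let q := θ.rangeRestrict g
  have hq : orderOf q = N := by
    rw [← Subgroup.orderOf_coe]
    change orderOf (θP g, θR g) = N
    rw [Prod.orderOf_mk, hθP]
    exact Nat.lcm_eq_left ((orderOf_dvd_natCard _).trans ((Dvd.intro_left _ rfl).trans hdvd))
  obtain ⟨A, hA, htrans⟩ := exists_perm_zmod_of_orderOf q hN hq
  have hindex : ((Subgroup.zpowers (θR g)).comap θR).index ≤
      Nat.card (θ.range ⧸ Subgroup.zpowers q) := by
    change _ ≤ (Subgroup.zpowers q).index
    rw [← Subgroup.index_comap_of_surjective _ θ.rangeRestrict_surjective]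
    have := index_comap_ne_zero θ.rangeRestrict (Subgroup.zpowers q)
    have : ((Subgroup.zpowers q).comap θ.rangeRestrict).FiniteIndex := ⟨this⟩
    refine Subgroup.index_antitone fun x hx => ?_
    obtain ⟨k, hk⟩ := hx
    refine ⟨k, ?_⟩
    have := congrArg (fun y : θ.range => (y : P × R).2) hk
    simpa [q, θ] using this
  refine ⟨θ.range ⧸ Subgroup.zpowers q, inferInstance, A.comp θ.rangeRestrict, hA,
    fun x y => ?_, h2.trans hindex, fun h => (h3 h).trans hindex⟩
  obtain ⟨h, hh⟩ := htrans x y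
  obtain ⟨k, rfl⟩ := θ.rangeRestrict_surjective h
  exact ⟨k, hh⟩

end SideGroup

namespace PermWreath

variable {Ω F : Type*} [Group F]

/-- The element `s` of a permutational wreath product sends `ω` to `ω'` with label `x`. -/
def Moves (s : PermWreath Ω F) (ω ω' : Ω) (x : F) : Prop :=
  s.right ω = ω' ∧ s.left ω' = x

theorem Moves.mul {s t : PermWreath Ω F} {ω ω' ω'' : Ω} {x y : F} (ht : Moves t ω' ω'' y)
    (hs : Moves s ω ω' x) : Moves (t * s) ω ω'' (y * x) := by
  obtain ⟨rfl, rfl⟩ := hs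
  obtain ⟨rfl, rfl⟩ := ht
  exact ⟨rfl, mul_left_apply' t s _⟩

theorem moves_inr (σ : Equiv.Perm Ω) (ω : Ω) :
    Moves (SemidirectProduct.inr σ : PermWreath Ω F) ω (σ ω) 1 :=
  ⟨rfl, rfl⟩

theorem moves_inl (c : Ω → F) (ω : Ω) :
    Moves (SemidirectProduct.inl c : PermWreath Ω F) ω ω (c ω) :=
  ⟨rfl, rfl⟩

theorem moves_conj (c : Ω → F) (σ : Equiv.Perm Ω) (ω : Ω) :
    Moves (MulAut.conj (SemidirectProduct.inl c) (SemidirectProduct.inr σ) : PermWreath Ω F)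
      ω (σ ω) (c (σ ω) * (c ω)⁻¹) := by
  have h := ((moves_inl c (σ ω)).mul (moves_inr σ ω)).mul (moves_inl c⁻¹ ω)
  rw [mul_one, Pi.inv_apply] at h
  rwa [MulAut.conj_apply, ← map_inv]

theorem conj_inl_inr_of_invariant (c : Ω → F) (σ : Equiv.Perm Ω) (h : ∀ ω, c (σ ω) = c ω) :
    (MulAut.conj (SemidirectProduct.inl c) (SemidirectProduct.inr σ) : PermWreath Ω F) =
      SemidirectProduct.inr σ := by
  ext ω
  · obtain ⟨ω, rfl⟩ := σ.surjective ω
    rw [(moves_conj c σ ω).2, h, mul_inv_cancel]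
    rfl
  · rfl

end PermWreath

section Gluing

variable {G₁ G₂ : Type*} {X₁ X₂ : Type} [Group G₁] [Group G₂] {N : ℕ}

/-- The action on the first and third coordinates. -/
def permFirst (X₂ : Type) (A : G₁ →* Equiv.Perm (X₁ × ZMod N)) :
    G₁ →* Equiv.Perm (X₁ × X₂ × ZMod N) :=
  MonoidHom.toHomPerm
    { toFun := fun h ω => ((A h (ω.1, ω.2.2)).1, ω.2.1, (A h (ω.1, ω.2.2)).2)
      map_one' := by funext ω; simp; rfl
      map_mul' := fun a b => by funext ω; simp; rfl }

/-- The action on the second and third coordinates, the latter with reversed orientation. -/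
def permSecond (X₁ : Type) (A : G₂ →* Equiv.Perm (X₂ × ZMod N)) :
    G₂ →* Equiv.Perm (X₁ × X₂ × ZMod N) :=
  MonoidHom.toHomPerm
    { toFun := fun h ω => (ω.1, (A h (ω.2.1, -ω.2.2)).1, -(A h (ω.2.1, -ω.2.2)).2)
      map_one' := by funext ω; simp; rfl
      map_mul' := fun a b => by
        funext ω
        change (_, (A (a * b) _).1, -(A (a * b) _).2) =
          (ω.1, (A a ((A b _).1, - -(A b _).2)).1, -(A a ((A b _).1, - -(A b _).2)).2)
        simp }

theorem permFirst_apply (A : G₁ →* Equiv.Perm (X₁ × ZMod N)) (h : G₁) (x : X₁) (y : X₂)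
    (z : ZMod N) : permFirst X₂ A h (x, y, z) = ((A h (x, z)).1, y, (A h (x, z)).2) := rfl

theorem permSecond_apply (A : G₂ →* Equiv.Perm (X₂ × ZMod N)) (h : G₂) (x : X₁) (y : X₂)
    (z : ZMod N) : permSecond X₁ A h (x, y, z) = (x, (A h (y, -z)).1, -(A h (y, -z)).2) := rfl

open PermWreath in
/-- Two transitive actions in which `g₁` and `g₂` act by translation are glued to a homomorphism
from the amalgamated product to a wreath product over a free group of rank two. -/
theorem exists_permWreath_of_actions [Finite X₁] [Finite X₂] (hN : 0 < N) (g₁ : G₁) (g₂ : G₂)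
    (A₁ : G₁ →* Equiv.Perm (X₁ × ZMod N)) (A₂ : G₂ →* Equiv.Perm (X₂ × ZMod N))
    (hA₁ : ∀ x z, A₁ g₁ (x, z) = (x, z + 1)) (hA₂ : ∀ x z, A₂ g₂ (x, z) = (x, z + 1))
    (ht₁ : ∀ x y, ∃ h, A₁ h x = y) (ht₂ : ∀ x y, ∃ h, A₂ h x = y)
    (hX₁ : 3 ≤ Nat.card X₁) (hX₂ : 2 ≤ Nat.card X₂) :
    ∃ (Ω : Type) (_ : Finite Ω) (B₁ : G₁ →* PermWreath Ω (FreeGroup (Fin 2)))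
      (B₂ : G₂ →* PermWreath Ω (FreeGroup (Fin 2))) (ω : Ω), B₁ g₁ * B₂ g₂ = 1 ∧
      ∀ i, ∃ k ∈ B₁.range ⊔ B₂.range, Moves k ω ω (FreeGroup.of i) := by
  classical
  have : NeZero N := ⟨hN.ne'⟩
  have := Fintype.ofFinite X₁
  rw [Nat.card_eq_fintype_card] at hX₁
  obtain ⟨x₀, x₁, x₂, h₀₁, h₀₂, h₁₂⟩ := Fintype.two_lt_card_iff.1 hX₁
  have := Finite.one_lt_card_iff_nontrivial.1 hX₂
  obtain ⟨y₀, y₁, hy⟩ := exists_pair_ne X₂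
  let κ (x : X₁) : FreeGroup (Fin 2) :=
    if x = x₁ then FreeGroup.of 0 else if x = x₂ then FreeGroup.of 1 else 1
  let c (ω : X₁ × X₂ × ZMod N) : FreeGroup (Fin 2) := if ω.2.1 = y₁ then κ ω.1 else 1
  let B₁ : G₁ →* PermWreath (X₁ × X₂ × ZMod N) (FreeGroup (Fin 2)) :=
    SemidirectProduct.inr.comp (permFirst X₂ A₁)
  let B₂ : G₂ →* PermWreath (X₁ × X₂ × ZMod N) (FreeGroup (Fin 2)) :=
    (MulAut.conj (SemidirectProduct.inl c)).toMonoidHom.comp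
      (SemidirectProduct.inr.comp (permSecond X₁ A₂))
  have hg₂ : B₂ g₂ = SemidirectProduct.inr (permSecond X₁ A₂ g₂) := by
    refine conj_inl_inr_of_invariant c _ ?_
    rintro ⟨x, y, z⟩
    rw [permSecond_apply, hA₂]
  have hm₁ (x x' : X₁) (y : X₂) : ∃ k ∈ B₁.range ⊔ B₂.range, Moves k (x, y, 0) (x', y, 0) 1 := by
    obtain ⟨h, hh⟩ := ht₁ (x, 0) (x', 0)
    refine ⟨B₁ h, Subgroup.mem_sup_left ⟨h, rfl⟩, ?_⟩
    have := moves_inr (F := FreeGroup (Fin 2)) (permFirst X₂ A₁ h) (x, y, 0)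
    rwa [permFirst_apply, hh] at this
  have hm₂ (x : X₁) (y y' : X₂) : ∃ k ∈ B₁.range ⊔ B₂.range,
      Moves k (x, y, 0) (x, y', 0) (c (x, y', 0) * (c (x, y, 0))⁻¹) := by
    obtain ⟨h, hh⟩ := ht₂ (y, 0) (y', 0)
    refine ⟨B₂ h, Subgroup.mem_sup_right ⟨h, rfl⟩, ?_⟩
    have := moves_conj c (permSecond X₁ A₂ h) (x, y, 0)
    rwa [permSecond_apply, neg_zero, hh, neg_zero] at this
  have hκ (x : X₁) : ∃ k ∈ B₁.range ⊔ B₂.range, Moves k (x₀, y₀, 0) (x₀, y₀, 0) (κ x) := by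
    obtain ⟨k₁, hk₁, h₁⟩ := hm₁ x₀ x y₀
    obtain ⟨k₂, hk₂, h₂⟩ := hm₂ x y₀ y₁
    obtain ⟨k₃, hk₃, h₃⟩ := hm₁ x x₀ y₁
    obtain ⟨k₄, hk₄, h₄⟩ := hm₂ x₀ y₁ y₀
    refine ⟨_, mul_mem hk₄ (mul_mem hk₃ (mul_mem hk₂ hk₁)), ?_⟩
    convert h₄.mul (h₃.mul (h₂.mul h₁)) using 1
    simp [c, hy, κ, h₀₁, h₀₂]
  refine ⟨X₁ × X₂ × ZMod N, inferInstance, B₁, B₂, (x₀, y₀, 0), ?_, fun i => ?_⟩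
  · rw [hg₂]
    change SemidirectProduct.inr _ * _ = _
    rw [← map_mul, map_eq_one_iff _ SemidirectProduct.inr_injective]
    ext ⟨x, y, z⟩ : 1
    rw [Equiv.Perm.mul_apply, permSecond_apply, hA₂, permFirst_apply, hA₁]
    simp
  · fin_cases i
    · simpa [κ] using hκ x₁
    · simpa [κ, h₁₂.symm] using hκ x₂

end Gluing

section Solvable

open Subgroup

theorem isSolvable_of_quotient_zpowers {G : Type*} [Group G] (a : G) [(zpowers a).Normal]
    [Group.IsSolvable (G ⧸ zpowers a)] : Group.IsSolvable G := by
  have : Group.IsSolvable (zpowers a) :=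
    Group.isSolvable_of_comm fun x y => mul_comm' x y
  exact Group.isSolvable_of_ker_le_range (zpowers a).subtype (QuotientGroup.mk' (zpowers a)) (by simp)

theorem mem_normalizer_zpowers {G : Type*} [Group G] {x z : G}
    (h : x * z * x⁻¹ = z ∨ x * z * x⁻¹ = z⁻¹) : x ∈ normalizer (zpowers z : Set G) := by
  rw [mem_normalizer_iff_map_conj_eq, MonoidHom.map_zpowers]
  change zpowers (x * z * x⁻¹) = _
  rcases h with h | h <;> rw [h]
  exact zpowers_inv

theorem normal_zpowers_of_closure {G : Type*} [Group G] {s : Set G} {z : G}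
    (hs : closure s = ⊤) (h : ∀ x ∈ s, x ∈ normalizer (zpowers z : Set G)) :
    (zpowers z).Normal := by
  rw [← normalizer_eq_top_iff, eq_top_iff, ← hs, closure_le]
  exact h

theorem isSolvable_of_closure_sq_eq_one {G : Type*} [Group G] {x y : G}
    (h : closure {x, y} = ⊤) (hx : x ^ 2 = 1) (hy : y ^ 2 = 1) : Group.IsSolvable G := by
  rw [sq] at hx hy
  have hx' := inv_eq_of_mul_eq_one_left hx
  have hy' := inv_eq_of_mul_eq_one_left hy
  have : (zpowers (x * y)).Normal := by
    refine normal_zpowers_of_closure h ?_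
    rintro _ (rfl | rfl) <;> refine mem_normalizer_zpowers (Or.inr ?_) <;>
      rw [mul_inv_rev, hx', hy']
    · rw [← mul_assoc, hx, one_mul]
    · rw [mul_assoc, mul_assoc, hy, mul_one]
  let π := QuotientGroup.mk' (zpowers (x * y))
  have hπ : π x * π y = 1 := by
    rw [← map_mul]
    exact (QuotientGroup.eq_one_iff _).2 (mem_zpowers _)
  have hxy : π y = π x := by
    rw [← inv_eq_of_mul_eq_one_right hπ, ← map_inv, hx']
  have htop : zpowers (π x) = ⊤ := by
    rw [eq_top_iff, ← map_top_of_surjective π (QuotientGroup.mk'_surjective _), ← h,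
      MonoidHom.map_closure, closure_le]
    rintro _ ⟨_, rfl | rfl, rfl⟩
    · exact mem_zpowers _
    · rw [hxy]; exact mem_zpowers _
  have : Group.IsSolvable (G ⧸ zpowers (x * y)) := by
    refine Group.isSolvable_of_comm fun a b => ?_
    obtain ⟨k, rfl⟩ := mem_zpowers_iff.1 (htop ▸ mem_top a)
    obtain ⟨l, rfl⟩ := mem_zpowers_iff.1 (htop ▸ mem_top b)
    exact (Commute.refl (π x)).zpow_zpow k l
  exact isSolvable_of_quotient_zpowers (x * y)

theorem isSolvable_of_closure {G : Type*} [Group G] {x y z : G}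
    (h : closure {x, y, z} = ⊤) (hx : x ∈ normalizer (zpowers z : Set G))
    (hy : y ∈ normalizer (zpowers z : Set G)) (hx2 : x ^ 2 ∈ zpowers z)
    (hy2 : y ^ 2 ∈ zpowers z) : Group.IsSolvable G := by
  have : (zpowers z).Normal := by
    refine normal_zpowers_of_closure h ?_
    rintro _ (rfl | rfl | rfl)
    exacts [hx, hy, le_normalizer (mem_zpowers _)]
  let π := QuotientGroup.mk' (zpowers z)
  have : Group.IsSolvable (G ⧸ zpowers z) := by
    refine isSolvable_of_closure_sq_eq_one (x := π x) (y := π y) ?_ ?_ ?_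
    · rw [eq_top_iff, ← map_top_of_surjective π (QuotientGroup.mk'_surjective _), ← h,
        MonoidHom.map_closure, closure_le]
      rintro _ ⟨w, rfl | rfl | hw, rfl⟩
      · exact subset_closure (by simp)
      · exact subset_closure (by simp)
      · have hw : π w = 1 := (QuotientGroup.eq_one_iff _).2 (hw ▸ mem_zpowers _)
        rw [hw]
        exact one_mem _
    · exact (QuotientGroup.eq_one_iff _).2 hx2
    · exact (QuotientGroup.eq_one_iff _).2 hy2
  exact isSolvable_of_quotient_zpowers z

theorem SideGroup.IsSmall.exists_normalizer {n : ℕ} {S T : Set (Fin n)} {e : Fin n → ℕ}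
    {g : SideGroup S T e} (hg : g.IsSmall) {H : Type*} [Group H] (j : SideGroup S T e →* H) :
    ∃ x : H, x ∈ normalizer (zpowers (j g) : Set H) ∧ x ^ 2 ∈ zpowers (j g) ∧
      ∀ i ∈ S, j (gen i) ∈ closure {x, j g} := by
  rcases hg with ⟨i, hS, rfl⟩ | ⟨i, k, hik, hS, hi, hk, rfl⟩
  · refine ⟨j (gen i), mem_normalizer_zpowers (Or.inl ?_), ?_, fun l hl => ?_⟩
    · rw [map_pow, mul_inv_eq_iff_eq_mul]
      exact (Commute.refl (j (gen i))).pow_right 2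
    · rw [map_pow]
      exact mem_zpowers _
    · rw [hS] at hl
      obtain rfl := hl
      exact subset_closure (by simp)
  · have ha : j (gen i) * j (gen i) = 1 := by
      rw [← map_mul, gen_mul_self (by simp [hS]) hi, map_one]
    have hb : j (gen k) * j (gen k) = 1 := by
      rw [← map_mul, gen_mul_self (by simp [hS]) hk, map_one]
    refine ⟨j (gen i), mem_normalizer_zpowers (Or.inr ?_), ?_, fun l hl => ?_⟩
    · rw [map_mul, mul_inv_rev, ← mul_assoc, ha, one_mul, inv_eq_of_mul_eq_one_left hb]
    · rw [sq, ha]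
      exact one_mem _
    · rw [hS] at hl
      rcases hl with rfl | rfl
      · exact subset_closure (by simp)
      · have : j (gen l) = j (gen i) * j (gen i * gen l) := by
          rw [map_mul, ← mul_assoc, ha, one_mul]
        rw [this]
        exact mul_mem (subset_closure (by simp)) (subset_closure (by simp))

end Solvable

theorem FreeGroup.lift_eq_of_forall_mem_toWord {α H : Type*} [DecidableEq α] [Group H]
    (f : α → H) (φ : FreeGroup α →* H) (W : FreeGroup α)
    (h : ∀ x ∈ W.toWord, f x.1 = φ (FreeGroup.of x.1)) : FreeGroup.lift f W = φ W := by
  have hφ : φ = FreeGroup.lift fun i => φ (FreeGroup.of i) := by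
    ext i; simp
  rw [← FreeGroup.mk_toWord (x := W), hφ, FreeGroup.lift_mk, FreeGroup.lift_mk]
  congr 1
  refine List.map_congr_left fun x hx => ?_
  rw [h x hx]

theorem SideGroup.range_le {n : ℕ} {S T : Set (Fin n)} {e : Fin n → ℕ} {H : Type*} [Group H]
    (hST : ∀ i, i ∈ T ↔ i ∉ S) (B : SideGroup S T e →* H) {K : Subgroup H}
    (h : ∀ i ∈ S, B (gen i) ∈ K) : B.range ≤ K := by
  have hmem (i : Fin n) : B (gen i) ∈ K := by
    by_cases hi : i ∈ S
    · exact h i hi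
    · rw [gen_eq_one ((hST i).2 hi), map_one]
      exact one_mem _
  rintro _ ⟨g, rfl⟩
  induction g using induction_gen with
  | one => rw [map_one]; exact one_mem _
  | mul_gen g i hg => rw [map_mul]; exact mul_mem hg (hmem i)
  | mul_gen_inv g i hg => rw [map_mul, map_inv]; exact mul_mem hg (inv_mem (hmem i))

namespace FPaper.FTypeBase

open Subgroup SideGroup

variable {D : FTypeBase}

/-- The indices of the generators of the first factor. -/
abbrev left (D : FTypeBase) : Set (Fin D.n) := {i | (i : ℕ) < D.p}

/-- The indices of the generators of the second factor. -/
abbrev right (D : FTypeBase) : Set (Fin D.n) := {i | D.p ≤ (i : ℕ)}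

/-- The first factor, as a free product of cyclic groups. -/
abbrev LeftGroup (D : FTypeBase) := SideGroup D.left D.right D.e

/-- The second factor, as a free product of cyclic groups. -/
abbrev RightGroup (D : FTypeBase) := SideGroup D.right D.left D.e

theorem mem_right_iff (i : Fin D.n) : i ∈ D.right ↔ i ∉ D.left := by simp

theorem mem_left_iff (i : Fin D.n) : i ∈ D.left ↔ i ∉ D.right := by simp

/-- The element of the first factor given by the word `U`. -/
abbrev leftElem (D : FTypeBase) : D.LeftGroup := PresentedGroup.mk _ D.U

/-- The element of the second factor given by the word `V`. -/
abbrev rightElem (D : FTypeBase) : D.RightGroup := PresentedGroup.mk _ D.V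

/-- The universal property of the amalgamated product. -/
theorem exists_hom_of_mul_eq_one (hD : D.IsFType) {H : Type*} [Group H] (B₁ : D.LeftGroup →* H)
    (B₂ : D.RightGroup →* H) (h : B₁ D.leftElem * B₂ D.rightElem = 1) :
    ∃ Φ : D.Gp →* H, B₁.range ⊔ B₂.range ≤ Φ.range := by
  classical
  obtain ⟨-, -, -, -, hU, hV, -⟩ := hD
  let f (i : Fin D.n) : H := if i ∈ D.left then B₁ (gen i) else B₂ (gen i)
  have hf₁ (i : Fin D.n) (hi : i ∈ D.left) : f i = B₁ (gen i) := if_pos hi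
  have hf₂ (i : Fin D.n) (hi : i ∈ D.right) : f i = B₂ (gen i) := if_neg ((mem_right_iff i).1 hi)
  let Φ : D.Gp →* H := PresentedGroup.toGroup (f := f) (by
    rintro r (⟨i, rfl⟩ | rfl)
    · rw [map_pow, FreeGroup.lift_apply_of]
      by_cases hi : i ∈ D.left
      · rw [hf₁ i hi, ← map_pow, gen_pow hi, map_one]
      · have hi := (mem_right_iff i).2 hi
        rw [hf₂ i hi, ← map_pow, gen_pow hi, map_one]
    · rw [map_mul,
        FreeGroup.lift_eq_of_forall_mem_toWord f (B₁.comp (PresentedGroup.mk _)) D.U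
          fun x hx => hf₁ _ (hU x hx),
        FreeGroup.lift_eq_of_forall_mem_toWord f (B₂.comp (PresentedGroup.mk _)) D.V
          fun x hx => hf₂ _ (hV x hx)]
      exact h)
  have hΦ (i : Fin D.n) : Φ (PresentedGroup.of i) = f i := PresentedGroup.toGroup.of _
  exact ⟨Φ, sup_le (range_le mem_right_iff B₁ fun i hi => ⟨_, (hΦ i).trans (hf₁ i hi)⟩)
    (range_le mem_left_iff B₂ fun i hi => ⟨_, (hΦ i).trans (hf₂ i hi)⟩)⟩

/-- The natural homomorphism from a factor to the amalgamated product. -/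
theorem exists_factorHom {S T : Set (Fin D.n)} (hST : ∀ i, i ∈ T ↔ i ∉ S)
    (W : FreeGroup (Fin D.n)) (hW : ∀ x ∈ W.toWord, x.1 ∈ S) :
    ∃ j : SideGroup S T D.e →* D.Gp, (∀ i ∈ S, j (gen i) = PresentedGroup.of i) ∧
      j (PresentedGroup.mk _ W) = PresentedGroup.mk _ W := by
  classical
  let f (i : Fin D.n) : D.Gp := if i ∈ S then PresentedGroup.of i else 1
  let j : SideGroup S T D.e →* D.Gp := lift f
    (by
      intro i hi
      rw [show f i = PresentedGroup.of i from if_pos hi, PresentedGroup.of, ← map_pow]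
      exact PresentedGroup.one_of_mem (Or.inl ⟨i, rfl⟩))
    (fun i hi => if_neg ((hST i).1 hi))
  have hj (i : Fin D.n) (hi : i ∈ S) : j (gen i) = PresentedGroup.of i :=
    (lift_gen ..).trans (if_pos hi)
  refine ⟨j, hj, ?_⟩
  have h1 := FreeGroup.lift_eq_of_forall_mem_toWord (fun i => (PresentedGroup.of i : D.Gp))
    (PresentedGroup.mk _) W fun x _ => rfl
  rw [← h1, FreeGroup.lift_eq_of_forall_mem_toWord _ (j.comp (PresentedGroup.mk _)) W
    fun x hx => (hj _ (hW x hx)).symm]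
  rfl

/-- If both amalgamated elements are exceptional, then the group is solvable. -/
theorem isSolvable_of_isSmall (hD : D.IsFType) (hl : IsSmall D.leftElem)
    (hr : IsSmall D.rightElem) : Group.IsSolvable D.Gp := by
  obtain ⟨-, -, -, -, hU, hV, -⟩ := hD
  obtain ⟨j₁, hj₁, hjU⟩ := exists_factorHom mem_right_iff D.U hU
  obtain ⟨j₂, hj₂, hjV⟩ := exists_factorHom mem_left_iff D.V hV
  obtain ⟨x, hx, hx2, hxS⟩ := hl.exists_normalizer j₁
  obtain ⟨y, hy, hy2, hyS⟩ := hr.exists_normalizer j₂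
  rw [hjU] at hx hx2 hxS
  rw [hjV] at hy hy2 hyS
  set z : D.Gp := PresentedGroup.mk _ D.U with hz
  have hzV : (PresentedGroup.mk _ D.V : D.Gp) = z⁻¹ := by
    rw [eq_comm, inv_eq_iff_mul_eq_one, hz, ← map_mul]
    exact PresentedGroup.one_of_mem (Or.inr rfl)
  rw [hzV] at hy hy2 hyS
  rw [zpowers_inv] at hy hy2
  refine isSolvable_of_closure (x := x) (y := y) (z := z) ?_ hx hy hx2 hy2
  rw [eq_top_iff, ← PresentedGroup.closure_range_of, closure_le]
  rintro _ ⟨i, rfl⟩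
  by_cases hi : i ∈ D.left
  · rw [← hj₁ i hi]
    exact closure_mono (by simp [Set.insert_subset_iff]) (hxS i hi)
  · have hi := (mem_right_iff i).2 hi
    rw [← hj₂ i hi]
    have hle : closure {y, z⁻¹} ≤ closure {x, y, z} := by
      rw [closure_le]
      rintro _ (rfl | rfl)
      · exact subset_closure (by simp)
      · exact inv_mem (subset_closure (by simp))
    exact hle (hyS i hi)

theorem leftElem_cases (hD : D.IsFType) :
    (∃ i, ∃ m ≥ 2, D.left = {i} ∧ D.leftElem = gen i ^ m) ∨
      ∃ i ∈ D.left, ∃ j ∈ D.left, i ≠ j := by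
  obtain ⟨hn, -, hp, hpn, -, -, -, -, -, -, hU, -⟩ := hD
  by_cases hp1 : D.p = 1
  · obtain ⟨i, m, hi, hm, hUi⟩ := hU hp1
    refine Or.inl ⟨i, m, hm, ?_, by rw [leftElem, hUi, map_pow]; rfl⟩
    ext k
    simp only [Set.mem_ofPred_eq, Set.mem_singleton_iff, Fin.ext_iff]
    omega
  · refine Or.inr ⟨⟨0, by omega⟩, ?_, ⟨1, by omega⟩, ?_, by simp⟩ <;>
      simp only [Set.mem_ofPred_eq] <;> omega

theorem rightElem_cases (hD : D.IsFType) :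
    (∃ i, ∃ m ≥ 2, D.right = {i} ∧ D.rightElem = gen i ^ m) ∨
      ∃ i ∈ D.right, ∃ j ∈ D.right, i ≠ j := by
  obtain ⟨hn, -, hp, hpn, -, -, -, -, -, -, -, hV⟩ := hD
  by_cases hp1 : D.p = D.n - 1
  · obtain ⟨i, m, hi, hm, hVi⟩ := hV hp1
    refine Or.inl ⟨i, m, hm, ?_, by rw [rightElem, hVi, map_pow]; rfl⟩
    ext k
    have := k.2
    simp only [Set.mem_ofPred_eq, Set.mem_singleton_iff, Fin.ext_iff]
    omega
  · refine Or.inr ⟨⟨D.p, by omega⟩, ?_, ⟨D.p + 1, by omega⟩, ?_, by simp⟩ <;>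
      simp only [Set.mem_ofPred_eq] <;> omega

/-- A homomorphism from the amalgamated product to a wreath product over a free group of rank two
whose point stabiliser surjects onto the free group. -/
theorem exists_permWreath (hD : D.IsFType)
    (h : ¬ (IsSmall D.leftElem ∧ IsSmall D.rightElem)) :
    ∃ (Ω : Type) (_ : Finite Ω) (Φ : D.Gp →* PermWreath Ω (FreeGroup (Fin 2))) (ω : Ω),
      ∀ i, ∃ k, PermWreath.Moves (Φ k) ω ω (FreeGroup.of i) := by
  have he := hD.2.1
  have hu : ¬ IsOfFinOrder D.leftElem := hD.2.2.2.2.2.2.2.2.1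
  have hv : ¬ IsOfFinOrder D.rightElem := hD.2.2.2.2.2.2.2.2.2.1
  obtain ⟨L₁, hL₁, h₁⟩ := exists_action mem_right_iff he _ hu (leftElem_cases hD)
  obtain ⟨L₂, hL₂, h₂⟩ := exists_action mem_left_iff he _ hv (rightElem_cases hD)
  have hL := Nat.mul_pos hL₁ hL₂
  obtain ⟨X₁, _, A₁, hA₁, ht₁, hc₁, hc₁'⟩ := h₁ (L₁ * L₂) hL (Dvd.intro _ rfl)
  obtain ⟨X₂, _, A₂, hA₂, ht₂, hc₂, hc₂'⟩ := h₂ (L₁ * L₂) hL (Dvd.intro_left _ rfl)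
  obtain ⟨Ω, hΩ, B₁, B₂, ω, hB, hω⟩ : ∃ (Ω : Type) (_ : Finite Ω)
      (B₁ : D.LeftGroup →* PermWreath Ω (FreeGroup (Fin 2)))
      (B₂ : D.RightGroup →* PermWreath Ω (FreeGroup (Fin 2))) (ω : Ω),
      B₁ D.leftElem * B₂ D.rightElem = 1 ∧
      ∀ i, ∃ k ∈ B₁.range ⊔ B₂.range, PermWreath.Moves k ω ω (FreeGroup.of i) := by
    by_cases hs : IsSmall D.leftElem
    · have hs₂ : ¬ IsSmall D.rightElem := fun h' => h ⟨hs, h'⟩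
      obtain ⟨Ω, hΩ, B₂, B₁, ω, hB, hω⟩ :=
        exists_permWreath_of_actions hL _ _ A₂ A₁ hA₂ hA₁ ht₂ ht₁ (hc₂' hs₂) hc₁
      exact ⟨Ω, hΩ, B₁, B₂, ω, mul_eq_one_comm.1 hB, by rwa [sup_comm]⟩
    · exact exists_permWreath_of_actions hL _ _ A₁ A₂ hA₁ hA₂ ht₁ ht₂ (hc₁' hs) hc₂
  obtain ⟨Φ, hΦ⟩ := exists_hom_of_mul_eq_one hD B₁ B₂ hB
  refine ⟨Ω, hΩ, Φ, ω, fun i => ?_⟩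
  obtain ⟨k, hk, hki⟩ := hω i
  obtain ⟨k, rfl⟩ := hΦ hk
  exact ⟨k, hki⟩

end FPaper.FTypeBase

namespace FPaper

/-- A non-solvable group of F-type has a finite-index subgroup mapping onto a
free group of rank `2`; in particular, a group of F-type is either SQ-universal or solvable. -/
theorem fType_sq_universal_or_solvable (G : Type*) [Group G] (hG : IsFTypeGroup G) :
    (¬ IsSolvable G → ∃ H : Subgroup G, H.FiniteIndex ∧
        ∃ f : H →* FreeGroup (Fin 2), Function.Surjective f) ∧
    (SQUniversal G ∨ IsSolvable G) := by
  have hlarge (hs : ¬ Group.IsSolvable G) : ∃ H : Subgroup G, H.FiniteIndex ∧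
      ∃ f : H →* FreeGroup (Fin 2), Function.Surjective f := by
    obtain ⟨D, hD, ⟨E⟩⟩ := hG
    obtain ⟨Ω, _, Φ, ω, hω⟩ := FTypeBase.exists_permWreath hD fun h => hs <| by
      have := FTypeBase.isSolvable_of_isSmall hD h.1 h.2
      exact Group.isSolvable_of_isSolvable_injective (f := E.toMonoidHom) E.injective
    refine exists_finiteIndex_surjective_of_permWreath (Φ.comp E.toMonoidHom) ω
      (Set.range FreeGroup.of) (FreeGroup.closure_range_of _) ?_
    rintro _ ⟨i, rfl⟩
    obtain ⟨k, hk⟩ := hω i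
    refine ⟨E.symm k, ?_⟩
    simpa [PermWreath.Moves] using hk
  refine ⟨hlarge, or_iff_not_imp_right.2 fun hs C _ _ => ?_⟩
  obtain ⟨H, _, f, hf⟩ := hlarge hs
  exact exists_embedding_quotient_of_large H f hf C

end FPaper
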